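/- Let n > 1 be an odd integer. Then, modulo [n]·Φ_n(q)^3, the following q-congruence of rational functions holds: Σ_{k=0}^{n-1} ([3k][2k][k]^2 / ([2k-1]·(-q;q)_k^4)) · ([2k choose k]_q)^3 · q^{-(k^2+3k)/2} ≡ [n]·q^{-(n+1)/2} + (1+q)·[n]^3 + ((n^2-1)(1-q)^2/24)·[n]^3·q^{-(n+1)/2}. -/

import Mathlib

open Finset Polynomial

/-- The variable `q`, viewed as a rational function over `ℚ`. -/
noncomputable def q : RatFunc ℚ := RatFunc.X

/-- The q-shifted factorial `(a; b)_n = (1-a)(1-ab)⋯(1-ab^{n-1})`. -/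
noncomputable def qpoch (a b : RatFunc ℚ) (n : ℕ) : RatFunc ℚ :=
  ∏ i ∈ Finset.range n, (1 - a * b ^ i)

/-- The q-integer `[m] = (1-q^m)/(1-q)` (for an arbitrary integer `m`). -/
noncomputable def qint (m : ℤ) : RatFunc ℚ := (1 - q ^ m) / (1 - q)

/-- The q-integer `[n] = 1 + q + ⋯ + q^{n-1}` as a polynomial. -/
noncomputable def qintPoly (n : ℕ) : Polynomial ℚ := ∑ i ∈ Finset.range n, Polynomial.X ^ i

/-- The central q-binomial coefficient `[2k choose k] = (q;q)_{2k}/(q;q)_k^2`. -/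
noncomputable def qcb (k : ℕ) : RatFunc ℚ := qpoch q q (2 * k) / (qpoch q q k) ^ 2

/-- Two rational functions are congruent modulo a polynomial `P` iff `P` divides the
numerator of the reduced form of their difference. -/
def ratCongr (A B : RatFunc ℚ) (P : Polynomial ℚ) : Prop := P ∣ (A - B).num

section CubicSum
variable {K : Type*} [Field K]

/-- The numerator of the term ratio of `quadProd`. -/
def quadNum (q a d P : K) (i : ℕ) : K :=
  (1 - a * q ^ i) * (1 - d * q ^ (2 * i)) * (d - a ^ 2 * q * P * q ^ (2 * i)) * (P - q ^ (2 * i))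

/-- The denominator of the term ratio of `quadProd`. -/
def quadDen (q a d P : K) (i : ℕ) : K :=
  (1 - q ^ (2 * i + 2)) * (1 - a * q * P * q ^ i) * q ^ i *
    ((d - a * q ^ (i + 1)) * (a * P - d * q ^ i))

/-- The coefficient of `1 - a * q ^ (3 * k)` in the terminating sum with parameter `P`. -/
def quadProd (q a d P : K) (k : ℕ) : K := ∏ i ∈ range k, (quadNum q a d P i / quadDen q a d P i)

/-- The quotient of the sums of `quadProd` with parameters `q ^ 2 * P` and `P`. -/
def quadFactor (q a d P : K) : K :=
  (1 - a * q * P) * (a * q ^ 2 * P - 1) * d / ((d - a * q * P) * (a * q ^ 2 * P - d))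

/-- The quotient of `quadProd` at `P` by `quadProd` at `q ^ 2 * P`. -/
def quadRatio (q a d P : K) (k : ℕ) : K :=
  ((d - a ^ 2 * q * P) * (q ^ 2 * P - q ^ (2 * k)) * (1 - a * q * P * q ^ k) *
        (1 - a * q ^ 2 * P * q ^ k) * (a * q * P - d) * (a * q ^ 2 * P - d) /
       ((d - a ^ 2 * q * P * q ^ (2 * k)) * (q ^ 2 * P - 1) * (1 - a * q * P) * (1 - a * q ^ 2 * P) *
        (a * q * P - d * q ^ k) * (a * q ^ 2 * P - d * q ^ k)))

/-- The parameters for which no denominator of the terminating sum vanishes. -/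
structure CubicGeneric (q a d : K) : Prop where
  q_ne : q ≠ 0
  a_ne : a ≠ 0
  d_ne : d ≠ 0
  pow_ne : ∀ i : ℕ, 0 < i → q ^ i ≠ 1
  mul_pow_ne_one : ∀ i : ℕ, a * q ^ i ≠ 1
  mul_pow_ne_mul_pow : ∀ i j : ℕ, a * q ^ i ≠ d * q ^ j
  sq_mul_pow_ne : ∀ i : ℕ, a ^ 2 * q ^ i ≠ d

variable {q a d : K}

theorem quadRatio_step (h : CubicGeneric q a d) (N k : ℕ) :
    quadRatio q a d (q ^ (2 * N)) k * (quadNum q a d (q ^ (2 * N)) k / quadDen q a d (q ^ (2 * N)) k)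
     = (quadNum q a d (q ^ 2 * q ^ (2 * N)) k / quadDen q a d (q ^ 2 * q ^ (2 * N)) k) * quadRatio q a d (q ^ (2 * N)) (k + 1) := by
  have a0 := h.q_ne
  have a1 : (1 : K) - q ^ (2 * k + 2) ≠ 0 := sub_ne_zero.2 (Ne.symm (h.pow_ne _ (by omega)))
  have a2 : q ^ (2 * N + 2) - 1 ≠ 0 := sub_ne_zero.2 (h.pow_ne _ (by omega))
  have g1 : ∀ i : ℕ, 1 - a * q ^ i ≠ 0 := fun i => sub_ne_zero.2 (Ne.symm (h.mul_pow_ne_one i))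
  have g2 : ∀ i j : ℕ, a * q ^ i - d * q ^ j ≠ 0 := fun i j => sub_ne_zero.2 (h.mul_pow_ne_mul_pow i j)
  have g3 : ∀ i : ℕ, d - a ^ 2 * q ^ i ≠ 0 := fun i => sub_ne_zero.2 (Ne.symm (h.sq_mul_pow_ne i))
  have b1 := g1 (1 + 2 * N)
  have b2 := g1 (2 + 2 * N)
  have b3 := g1 (1 + 2 * N + k)
  have b4 := g1 (2 + 2 * N + k)
  have b5 := g1 (3 + 2 * N + k)
  have c1 := g2 (2 * N) k
  have c2 := g2 (1 + 2 * N) k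
  have c3 := g2 (2 + 2 * N) k
  have c4 := g2 (1 + 2 * N) (k + 1)
  have c5 := g2 (2 + 2 * N) (k + 1)
  have c6 : d - a * q ^ (k + 1) ≠ 0 := by
    have := g2 (k + 1) 0
    intro h'; apply this; linear_combination -h'
  have d1 := g3 (1 + 2 * N + 2 * k)
  have d2 := g3 (1 + 2 * N + 2 * (k + 1))
  have d3 := g3 (3 + 2 * N + 2 * k)
  have e : q ^ k ≠ 0 := pow_ne_zero _ h.q_ne
  have r1 : q ^ 2 * q ^ (2 * N) - q ^ (2 * (k + 1)) = q ^ 2 * (q ^ (2 * N) - q ^ (2 * k)) := by ring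
  have r2 : a * q * q ^ (2 * N) - d * q ^ (k + 1) = q * (a * q ^ (2 * N) - d * q ^ k) := by ring
  have r3 : a * q ^ 2 * q ^ (2 * N) - d * q ^ (k + 1) = q * (a * q ^ (1 + 2 * N) - d * q ^ k) := by ring
  have r4 : 1 - a * q * q ^ (2 * N) * q ^ (k + 1) = 1 - a * q ^ (2 + 2 * N + k) := by ring
  have r5 : 1 - a * q ^ 2 * q ^ (2 * N) * q ^ (k + 1) = 1 - a * q ^ (3 + 2 * N + k) := by ring
  have r6 : d - a ^ 2 * q * q ^ (2 * N) * q ^ (2 * (k + 1)) = d - a ^ 2 * q ^ (3 + 2 * N + 2 * k) := by ring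
  have r7 : d - a ^ 2 * q * (q ^ 2 * q ^ (2 * N)) * q ^ (2 * k) = d - a ^ 2 * q ^ (3 + 2 * N + 2 * k) := by ring
  have r8 : 1 - a * q * (q ^ 2 * q ^ (2 * N)) * q ^ k = 1 - a * q ^ (3 + 2 * N + k) := by ring
  have r9 : a * (q ^ 2 * q ^ (2 * N)) - d * q ^ k = a * q ^ (2 + 2 * N) - d * q ^ k := by ring
  have r10 : a * q * q ^ (2 * N) - d * q ^ k = a * q ^ (1 + 2 * N) - d * q ^ k := by ring
  have r11 : a * q ^ 2 * q ^ (2 * N) - d * q ^ k = a * q ^ (2 + 2 * N) - d * q ^ k := by ring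
  have r12 : 1 - a * q * q ^ (2 * N) * q ^ k = 1 - a * q ^ (1 + 2 * N + k) := by ring
  have r13 : 1 - a * q ^ 2 * q ^ (2 * N) * q ^ k = 1 - a * q ^ (2 + 2 * N + k) := by ring
  have r14 : d - a ^ 2 * q * q ^ (2 * N) * q ^ (2 * k) = d - a ^ 2 * q ^ (1 + 2 * N + 2 * k) := by ring
  have r15 : 1 - a * q * q ^ (2 * N) = 1 - a * q ^ (1 + 2 * N) := by ring
  have r16 : 1 - a * q ^ 2 * q ^ (2 * N) = 1 - a * q ^ (2 + 2 * N) := by ring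
  have r17 : q ^ 2 * q ^ (2 * N) - 1 = q ^ (2 * N + 2) - 1 := by ring
  unfold quadNum quadDen quadRatio
  rw [r1, r2, r3, r4, r5, r6, r7, r8, r9, r10, r11, r12, r13, r14, r15, r16, r17]
  generalize 1 - a * q ^ (1 + 2 * N) = x1 at *
  generalize 1 - a * q ^ (2 + 2 * N) = x2 at *
  generalize 1 - a * q ^ (1 + 2 * N + k) = x3 at *
  generalize 1 - a * q ^ (2 + 2 * N + k) = x4 at *
  generalize 1 - a * q ^ (3 + 2 * N + k) = x5 at *
  generalize a * q ^ (2 * N) - d * q ^ k = y1 at *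
  generalize a * q ^ (1 + 2 * N) - d * q ^ k = y2 at *
  generalize a * q ^ (2 + 2 * N) - d * q ^ k = y3 at *
  generalize d - a * q ^ (k + 1) = y4 at *
  generalize d - a ^ 2 * q ^ (1 + 2 * N + 2 * k) = z1 at *
  generalize d - a ^ 2 * q ^ (3 + 2 * N + 2 * k) = z3 at *
  generalize 1 - q ^ (2 * k + 2) = x6 at *
  generalize q ^ (2 * N + 2) - 1 = x7 at *
  generalize q ^ (2 * N) - q ^ (2 * k) = x8 at *
  generalize q ^ k = Q at *
  clear r1 r2 r3 r4 r5 r6 r7 r8 r9 r10 r11 r12 r13 r14 r15 r16 r17 g1 g2 g3 h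
  field_simp

/-- The effect on `quadProd` of replacing `P` by `q ^ 2 * P`. -/
theorem quadProd_shift (h : CubicGeneric q a d) (N k : ℕ) :
    quadProd q a d (q ^ (2 * N)) k =
      quadProd q a d (q ^ 2 * q ^ (2 * N)) k * quadRatio q a d (q ^ (2 * N)) k := by
  induction k with
  | zero =>
    have a2 : q ^ (2 * N + 2) - 1 ≠ 0 := sub_ne_zero.2 (h.pow_ne _ (by omega))
    have g1 : ∀ i : ℕ, 1 - a * q ^ i ≠ 0 := fun i => sub_ne_zero.2 (Ne.symm (h.mul_pow_ne_one i))
    have g2 : ∀ i j : ℕ, a * q ^ i - d * q ^ j ≠ 0 := fun i j => sub_ne_zero.2 (h.mul_pow_ne_mul_pow i j)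
    have g3 : ∀ i : ℕ, d - a ^ 2 * q ^ i ≠ 0 := fun i => sub_ne_zero.2 (Ne.symm (h.sq_mul_pow_ne i))
    have b1 := g1 (1 + 2 * N)
    have b2 := g1 (2 + 2 * N)
    have b3 := g2 (1 + 2 * N) 0
    have b4 := g2 (2 + 2 * N) 0
    have b5 := g3 (1 + 2 * N)
    unfold quadProd quadRatio
    simp only [range_zero, prod_empty, mul_zero, pow_zero, mul_one, one_mul]
    symm
    refine (div_eq_one_iff_eq ?_).2 (by ring)
    · rw [mul_ne_zero_iff, mul_ne_zero_iff, mul_ne_zero_iff, mul_ne_zero_iff, mul_ne_zero_iff]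
      refine ⟨⟨⟨⟨⟨?_, ?_⟩, ?_⟩, ?_⟩, ?_⟩, ?_⟩
      · convert b5 using 1; ring
      · convert a2 using 1; ring
      · convert b1 using 1; ring
      · convert b2 using 1; ring
      · convert b3 using 1; ring
      · convert b4 using 1; ring
  | succ k ih =>
    unfold quadProd at ih ⊢
    rw [prod_range_succ, prod_range_succ, ih, mul_assoc, quadRatio_step h, mul_assoc]

theorem quad_certificate_identity (q a d P Q : K) :
    (1 - a * Q ^ 3) * ((d - a ^ 2 * q * P * Q ^ 2) * (q ^ 2 * P - 1) * (a * q * P - d * Q) *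
      (a * q ^ 2 * P - d * Q) - d * (d - a ^ 2 * q * P) * (q ^ 2 * P - Q ^ 2) *
        (1 - a * q * P * Q) * (1 - a * q ^ 2 * P * Q)) -
      (d - a ^ 2 * q ^ 3 * P ^ 2) * (1 - Q ^ 2) * (1 - a * q ^ 2 * P * Q) * Q * (d - a * Q) *
        (a * q * P - d * Q) +
      (d - a ^ 2 * q ^ 3 * P ^ 2) * (1 - a * Q) * (1 - d * Q ^ 2) * (q ^ 2 * P - Q ^ 2) *
        (d - a ^ 2 * q * P * Q ^ 2) = 0 := by
  ring

/-- The Wilf–Zeilberger certificate for the recurrence in `P` of the sum of `quadProd`. -/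
def quadCert (q a d P : K) (k : ℕ) : K :=
  -(d - a ^ 2 * q ^ 3 * P ^ 2) / (q ^ 2 * P - 1) *
    ((1 - (q ^ k) ^ 2) * (1 - a * q ^ 2 * P * q ^ k) * q ^ k * (d - a * q ^ k) /
      ((d - a ^ 2 * q * P * q ^ (2 * k)) * (a * q ^ 2 * P - d * q ^ k)))

theorem quadCert_step (h : CubicGeneric q a d) (N k : ℕ) :
    (1 - a * q ^ (3 * k)) * (1 - quadFactor q a d (q ^ (2 * N)) * quadRatio q a d (q ^ (2 * N)) k)
      + quadCert q a d (q ^ (2 * N)) k =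
      quadNum q a d (q ^ 2 * q ^ (2 * N)) k / quadDen q a d (q ^ 2 * q ^ (2 * N)) k *
       quadCert q a d (q ^ (2 * N)) (k + 1) := by
  have a0 := h.q_ne
  have x6 : (1 : K) - q ^ (2 * k + 2) ≠ 0 := sub_ne_zero.2 (Ne.symm (h.pow_ne _ (by omega)))
  have x7 : q ^ (2 * N + 2) - 1 ≠ 0 := sub_ne_zero.2 (h.pow_ne _ (by omega))
  have g1 : ∀ i : ℕ, 1 - a * q ^ i ≠ 0 := fun i => sub_ne_zero.2 (Ne.symm (h.mul_pow_ne_one i))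
  have g2 : ∀ i j : ℕ, a * q ^ i - d * q ^ j ≠ 0 := fun i j => sub_ne_zero.2 (h.mul_pow_ne_mul_pow i j)
  have g3 : ∀ i : ℕ, d - a ^ 2 * q ^ i ≠ 0 := fun i => sub_ne_zero.2 (Ne.symm (h.sq_mul_pow_ne i))
  have x1 := g1 (1 + 2 * N)
  have x2 := g1 (2 + 2 * N)
  have x5 := g1 (3 + 2 * N + k)
  have y2 := g2 (1 + 2 * N) k
  have y3 := g2 (2 + 2 * N) k
  have y4 := g2 (k + 1) 0
  have y5 := g2 (1 + 2 * N) 0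
  have y6 := g2 (2 + 2 * N) 0
  have z1 := g3 (1 + 2 * N + 2 * k)
  have z3 := g3 (3 + 2 * N + 2 * k)
  have e : q ^ k ≠ 0 := pow_ne_zero _ h.q_ne
  clear g1 g2 g3
  have A : quadFactor q a d (q ^ (2 * N)) * quadRatio q a d (q ^ (2 * N)) k =
      d * (d - a ^ 2 * q * q ^ (2 * N)) * (q ^ 2 * q ^ (2 * N) - (q ^ k) ^ 2) *
        (1 - a * q * q ^ (2 * N) * q ^ k) * (1 - a * q ^ 2 * q ^ (2 * N) * q ^ k) /
        ((d - a ^ 2 * q * q ^ (2 * N) * (q ^ k) ^ 2) * (q ^ 2 * q ^ (2 * N) - 1) *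
        (a * q * q ^ (2 * N) - d * q ^ k) * (a * q ^ 2 * q ^ (2 * N) - d * q ^ k)) := by
    unfold quadFactor quadRatio
    have r1 : (1 - a * q * q ^ (2 * N)) = 1 - a * q ^ (1 + 2 * N) := by ring
    have r2 : a * q ^ 2 * q ^ (2 * N) - 1 = - (1 - a * q ^ (2 + 2 * N)) := by ring
    have r3 : 1 - a * q ^ 2 * q ^ (2 * N) = (1 - a * q ^ (2 + 2 * N)) := by ring
    have r4 : d - a * q * q ^ (2 * N) = - (a * q ^ (1 + 2 * N) - d * q ^ 0) := by ring
    have r5 : a * q * q ^ (2 * N) - d = (a * q ^ (1 + 2 * N) - d * q ^ 0) := by ring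
    have r6 : a * q ^ 2 * q ^ (2 * N) - d = (a * q ^ (2 + 2 * N) - d * q ^ 0) := by ring
    have r7 : d - a ^ 2 * q * q ^ (2 * N) * q ^ (2 * k) = d - a ^ 2 * q ^ (1 + 2 * N + 2 * k) := by ring
    have r7' : d - a ^ 2 * q * q ^ (2 * N) * (q ^ k) ^ 2 = d - a ^ 2 * q ^ (1 + 2 * N + 2 * k) := by ring
    have r8 : q ^ 2 * q ^ (2 * N) - 1 = q ^ (2 * N + 2) - 1 := by ring
    have r9 : a * q * q ^ (2 * N) - d * q ^ k = a * q ^ (1 + 2 * N) - d * q ^ k := by ring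
    have r10 : a * q ^ 2 * q ^ (2 * N) - d * q ^ k = a * q ^ (2 + 2 * N) - d * q ^ k := by ring
    have r11 : q ^ (2 * k) = (q ^ k) ^ 2 := by ring
    rw [r7, r7', r11, r1, r2, r3, r4, r5, r6, r8, r9, r10]
    generalize 1 - a * q ^ (1 + 2 * N) = u1 at *
    generalize 1 - a * q ^ (2 + 2 * N) = u2 at *
    generalize a * q ^ (1 + 2 * N) - d * q ^ 0 = v1 at *
    generalize a * q ^ (2 + 2 * N) - d * q ^ 0 = v2 at *
    generalize a * q ^ (1 + 2 * N) - d * q ^ k = v3 at *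
    generalize a * q ^ (2 + 2 * N) - d * q ^ k = v4 at *
    generalize d - a ^ 2 * q ^ (1 + 2 * N + 2 * k) = v5 at *
    generalize q ^ (2 * N + 2) - 1 = v6 at *
    clear r1 r2 r3 r4 r5 r6 r7 r7' r8 r9 r10 r11
    field_simp
  have B : quadNum q a d (q ^ 2 * q ^ (2 * N)) k / quadDen q a d (q ^ 2 * q ^ (2 * N)) k *
       quadCert q a d (q ^ (2 * N)) (k + 1) =
       -(d - a ^ 2 * q ^ 3 * (q ^ (2 * N)) ^ 2) / (q ^ 2 * q ^ (2 * N) - 1) *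
       ((1 - a * q ^ k) * (1 - d * (q ^ k) ^ 2) * (q ^ 2 * q ^ (2 * N) - (q ^ k) ^ 2) /
        ((a * q ^ 2 * q ^ (2 * N) - d * q ^ k) * (a * q * q ^ (2 * N) - d * q ^ k))) := by
    unfold quadNum quadDen quadCert
    have r1 : 1 - a * q ^ 2 * q ^ (2 * N) * q ^ (k + 1) = 1 - a * q ^ (3 + 2 * N + k) := by ring
    have r2 : 1 - a * q * (q ^ 2 * q ^ (2 * N)) * q ^ k = 1 - a * q ^ (3 + 2 * N + k) := by ring
    have r3 : 1 - (q ^ (k + 1)) ^ 2 = 1 - q ^ (2 * k + 2) := by ring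
    have r4 : d - a * q ^ (k + 1) = - (a * q ^ (k + 1) - d * q ^ 0) := by ring
    have r5 : d - a ^ 2 * q * q ^ (2 * N) * q ^ (2 * (k + 1)) = d - a ^ 2 * q ^ (3 + 2 * N + 2 * k) := by ring
    have r6 : d - a ^ 2 * q * (q ^ 2 * q ^ (2 * N)) * q ^ (2 * k) = d - a ^ 2 * q ^ (3 + 2 * N + 2 * k) := by ring
    have r7 : a * (q ^ 2 * q ^ (2 * N)) - d * q ^ k = a * q ^ (2 + 2 * N) - d * q ^ k := by ring
    have r8 : a * q ^ 2 * q ^ (2 * N) - d * q ^ (k + 1) = q * (a * q ^ (1 + 2 * N) - d * q ^ k) := by ring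
    have r9 : a * q * q ^ (2 * N) - d * q ^ k = a * q ^ (1 + 2 * N) - d * q ^ k := by ring
    have r10 : a * q ^ 2 * q ^ (2 * N) - d * q ^ k = a * q ^ (2 + 2 * N) - d * q ^ k := by ring
    have r11 : q ^ (2 * k) = (q ^ k) ^ 2 := by ring
    have r12 : q ^ 2 * q ^ (2 * N) - 1 = q ^ (2 * N + 2) - 1 := by ring
    rw [r1, r2, r3, r4, r5, r6, r7, r8, r9, r10, r11, r12, pow_succ q k]
    generalize 1 - a * q ^ (3 + 2 * N + k) = u2 at *
    generalize a * q ^ (2 + 2 * N) - d * q ^ k = v4 at *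
    generalize a * q ^ (1 + 2 * N) - d * q ^ k = v3 at *
    generalize 1 - q ^ (2 * k + 2) = v7 at *
    generalize d - a ^ 2 * q ^ (3 + 2 * N + 2 * k) = v5 at *
    rw [← pow_succ q k]
    generalize a * q ^ (k + 1) - d * q ^ 0 = v1 at *
    rw [pow_succ q k]
    generalize q ^ (2 * N + 2) - 1 = v6 at *
    generalize q ^ k = Q at *
    clear r1 r2 r3 r4 r5 r6 r7 r8 r9 r10 r11 r12 A
    field_simp
  rw [A, B]
  unfold quadCert
  clear A B x1 x2 x5 x6 y4 y5 y6 z3 h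
  have key := quad_certificate_identity q a d (q ^ (2 * N)) (q ^ k)
  have n1 : a * q * q ^ (2 * N) - d * q ^ k ≠ 0 := by convert y2 using 1; ring
  have n2 : a * q ^ 2 * q ^ (2 * N) - d * q ^ k ≠ 0 := by convert y3 using 1; ring
  have n3 : d - a ^ 2 * q * q ^ (2 * N) * (q ^ k) ^ 2 ≠ 0 := by convert z1 using 1; ring
  have n4 : q ^ 2 * q ^ (2 * N) - 1 ≠ 0 := by convert x7 using 1; ring
  rw [show q ^ (3 * k) = (q ^ k) ^ 3 by ring, show q ^ (2 * k) = (q ^ k) ^ 2 by ring]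
  clear y2 y3 z1 x7
  generalize q ^ k = Q at *
  generalize q ^ (2 * N) = P at *
  rw [← sub_eq_zero]
  rw [← mul_left_inj' (mul_ne_zero (mul_ne_zero n3 n4) (mul_ne_zero n1 n2)), zero_mul]
  rw [← key]
  generalize hA : a * q * P - d * Q = A at *
  generalize hB : a * q ^ 2 * P - d * Q = B at *
  generalize hC : d - a ^ 2 * q * P * Q ^ 2 = C at *
  generalize hD : q ^ 2 * P - 1 = D at *
  field_simp
  ring

theorem sum_quad_wz (h : CubicGeneric q a d) (N k : ℕ) :
    ∑ i ∈ range k, (1 - a * q ^ (3 * i)) * (quadProd q a d (q ^ 2 * q ^ (2 * N)) i -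
      quadFactor q a d (q ^ (2 * N)) * quadProd q a d (q ^ (2 * N)) i) =
      quadProd q a d (q ^ 2 * q ^ (2 * N)) k * quadCert q a d (q ^ (2 * N)) k := by
  induction k with
  | zero => simp [quadCert]
  | succ k ih =>
    rw [sum_range_succ, ih, quadProd_shift h N k]
    have : quadProd q a d (q ^ 2 * q ^ (2 * N)) (k + 1) = quadProd q a d (q ^ 2 * q ^ (2 * N)) k *
       (quadNum q a d (q ^ 2 * q ^ (2 * N)) k / quadDen q a d (q ^ 2 * q ^ (2 * N)) k) :=
      prod_range_succ _ _
    rw [this, mul_assoc _ _ (quadCert q a d (q ^ (2 * N)) (k + 1)), ← quadCert_step h]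
    ring

theorem quadProd_eq_zero (N k : ℕ) (hk : N < k) : quadProd q a d (q ^ (2 * N)) k = 0 :=
  prod_eq_zero (mem_range.2 hk) (by simp [quadNum])

/-- Closed form of the terminating sum of `quadProd`. -/
theorem sum_quadProd (h : CubicGeneric q a d) (N : ℕ) :
    ∑ k ∈ range (N + 1), (1 - a * q ^ (3 * k)) * quadProd q a d (q ^ (2 * N)) k =
      (1 - a) * ∏ i ∈ range N, quadFactor q a d (q ^ (2 * i)) := by
  induction N with
  | zero => simp [quadProd]
  | succ N ih =>
    have := sum_quad_wz h N (N + 1 + 1)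
    rw [prod_range_succ, ← mul_assoc, ← ih]
    have e : q ^ 2 * q ^ (2 * N) = q ^ (2 * (N + 1)) := by ring
    rw [e, quadProd_eq_zero (N + 1) _ (by omega), zero_mul] at this
    simp only [mul_sub, sum_sub_distrib] at this
    rw [sub_eq_zero.1 this, sum_range_succ, quadProd_eq_zero N _ (by omega), sum_mul]
    simp only [mul_zero, add_zero]
    exact sum_congr rfl fun _ _ => by ring

section Cleared
variable {R S : Type*} [CommRing R] [CommRing S]

/-- The numerator of the term ratio of the terminating cubic sum, with `W = d + a ^ 2 * q * P / d`
for the parameter `d` of `quadProd`. -/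
def cubicNum (q a W P : R) (i : ℕ) : R :=
  (1 - a * q ^ i) * (1 - W * q ^ (2 * i) + a ^ 2 * q * P * q ^ (4 * i)) * (P - q ^ (2 * i))

/-- The denominator of the term ratio of the terminating cubic sum. -/
def cubicDen (q a W P : R) (i : ℕ) : R :=
  (1 - q ^ (2 * i + 2)) * (a * P - q ^ i * W + a * q ^ (2 * i + 1)) * (1 - a * q * P * q ^ i) * q ^ i

/-- The terminating cubic sum, multiplied by all the denominators `cubicDen`. -/
def clearedSum (q a W P : R) (N : ℕ) : R :=
  ∑ k ∈ range (N + 1), (1 - a * q ^ (3 * k)) * (∏ i ∈ range k, cubicNum q a W P i) *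
    ∏ i ∈ Ico k N, cubicDen q a W P i

/-- The closed form of `clearedSum` at `P = q ^ (2 * N)`. -/
def clearedValue (q a P : R) (N : ℕ) : R :=
  (1 - a) * ∏ i ∈ range N, ((1 - a * q ^ (2 * i + 1)) * (a * q ^ (2 * i + 2) - 1) *
    (1 - q ^ (2 * i + 2)) * (1 - a * q * P * q ^ i) * q ^ (2 * i))

theorem map_clearedSum (f : R →+* S) (q a W P : R) (N : ℕ) :
    f (clearedSum q a W P N) = clearedSum (f q) (f a) (f W) (f P) N := by
  simp [clearedSum, cubicNum, cubicDen, map_sum, map_prod]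

theorem map_clearedValue (f : R →+* S) (q a P : R) (N : ℕ) :
    f (clearedValue q a P N) = clearedValue (f q) (f a) (f P) N := by
  simp [clearedValue, map_prod]

end Cleared

theorem prod_range_two_mul_add_one {M : Type*} [CommMonoid M] (f : ℕ → M) (N : ℕ) :
    ∏ i ∈ range N, (f (2 * i) * f (2 * i + 1)) = ∏ i ∈ range (2 * N), f i := by
  induction N with
  | zero => simp
  | succ N ih => rw [prod_range_succ, ih, mul_add, mul_one, prod_range_succ, prod_range_succ, mul_assoc]

theorem quadNum_eq (hd : d ≠ 0) (P : K) (i : ℕ) :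
    quadNum q a d P i = d * cubicNum q a (d + a ^ 2 * q * P / d) P i := by
  unfold quadNum cubicNum
  field_simp
  ring

theorem quadDen_eq (hd : d ≠ 0) (P : K) (i : ℕ) :
    quadDen q a d P i = d * cubicDen q a (d + a ^ 2 * q * P / d) P i := by
  unfold quadDen cubicDen
  field_simp
  ring

theorem prod_quadDen (N : ℕ) :
    ∏ i ∈ range N, quadDen q a d (q ^ (2 * N)) i =
      (∏ i ∈ range N, ((1 - q ^ (2 * i + 2)) * (1 - a * q * q ^ (2 * N) * q ^ i) * q ^ (2 * i))) *
      ∏ i ∈ range N, ((d - a * q * q ^ (2 * i)) * (a * q ^ 2 * q ^ (2 * i) - d)) := by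
  have hm : (-1 : K) ^ N = ∏ _i ∈ range N, (-1 : K) := by simp
  have h1 : ∏ i ∈ range N, ((d - a * q * q ^ (2 * i)) * (a * q ^ 2 * q ^ (2 * i) - d)) =
      (-1) ^ N * ∏ i ∈ range (2 * N), (d - a * q ^ (i + 1)) := by
    rw [← prod_range_two_mul_add_one (fun i => d - a * q ^ (i + 1)), hm, ← prod_mul_distrib]
    exact prod_congr rfl fun i _ => by ring
  have h2 : ∏ i ∈ range N, (a * q ^ (2 * N) - d * q ^ i) =
      (-1) ^ N * (∏ i ∈ range N, q ^ i) * ∏ i ∈ range N, (d - a * q ^ (N + i + 1)) := by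
    rw [← prod_range_reflect (fun i => d - a * q ^ (N + i + 1))]
    rw [hm, ← prod_mul_distrib, ← prod_mul_distrib]
    refine prod_congr rfl fun i hi => ?_
    have hi := mem_range.1 hi
    have : q ^ (2 * N) = q ^ i * q ^ (N + (N - 1 - i) + 1) := by rw [← pow_add]; congr 1; omega
    rw [this]; ring
  have h3 : ∏ i ∈ range (2 * N), (d - a * q ^ (i + 1)) =
     (∏ i ∈ range N, (d - a * q ^ (i + 1))) * ∏ i ∈ range N, (d - a * q ^ (N + i + 1)) := by
    rw [two_mul, prod_range_add]
  rw [h1, h3]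
  unfold quadDen
  have h4 : ∏ i ∈ range N, q ^ (2 * i) = (∏ i ∈ range N, q ^ i) * ∏ i ∈ range N, q ^ i := by
    rw [← prod_mul_distrib]; exact prod_congr rfl fun i _ => by ring
  simp only [prod_mul_distrib]
  rw [h2, h4]
  ring

theorem clearedSum_of_generic (h : CubicGeneric q a d) (N : ℕ) :
    clearedSum q a (d + a ^ 2 * q * q ^ (2 * N) / d) (q ^ (2 * N)) N =
      clearedValue q a (q ^ (2 * N)) N := by
  have hden : ∀ i < N, quadDen q a d (q ^ (2 * N)) i ≠ 0 := by
    intro i hi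
    have x6 : (1 : K) - q ^ (2 * i + 2) ≠ 0 := sub_ne_zero.2 (Ne.symm (h.pow_ne _ (by omega)))
    have x1 : 1 - a * q * q ^ (2 * N) * q ^ i ≠ 0 := by
      have := sub_ne_zero.2 (Ne.symm (h.mul_pow_ne_one (1 + 2 * N + i)))
      convert this using 1; ring
    have x2 : d - a * q ^ (i + 1) ≠ 0 := by
      have := sub_ne_zero.2 (Ne.symm (h.mul_pow_ne_mul_pow (i + 1) 0))
      convert this using 1; ring
    have x3 := sub_ne_zero.2 (h.mul_pow_ne_mul_pow (2 * N) i)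
    exact mul_ne_zero (mul_ne_zero (mul_ne_zero x6 x1) (pow_ne_zero _ h.q_ne)) (mul_ne_zero x2 x3)
  set W := d + a ^ 2 * q * q ^ (2 * N) / d with hW
  have hc : ∀ i < N, cubicDen q a W (q ^ (2 * N)) i ≠ 0 := by
    intro i hi h0
    apply hden i hi
    rw [quadDen_eq h.d_ne, ← hW, h0, mul_zero]
  have hs : clearedSum q a W (q ^ (2 * N)) N = (∏ i ∈ range N, cubicDen q a W (q ^ (2 * N)) i) *
      ∑ k ∈ range (N + 1), (1 - a * q ^ (3 * k)) * quadProd q a d (q ^ (2 * N)) k := by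
    unfold clearedSum
    rw [mul_sum]
    refine sum_congr rfl fun k hk => ?_
    have hk : k ≤ N := by have := mem_range.1 hk; omega
    rw [← prod_range_mul_prod_Ico _ hk]
    have : quadProd q a d (q ^ (2 * N)) k * ∏ i ∈ range k, cubicDen q a W (q ^ (2 * N)) i =
        ∏ i ∈ range k, cubicNum q a W (q ^ (2 * N)) i := by
      unfold quadProd
      rw [← prod_mul_distrib]
      refine prod_congr rfl fun i hi => ?_
      have hi := mem_range.1 hi
      rw [quadNum_eq h.d_ne, quadDen_eq h.d_ne, ← hW]
      have := hc i (by omega)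
      have := h.d_ne
      field_simp
    rw [← this]; ring
  rw [hs, sum_quadProd h]
  have hdd : d ^ N * ∏ i ∈ range N, cubicDen q a W (q ^ (2 * N)) i =
      ∏ i ∈ range N, quadDen q a d (q ^ (2 * N)) i := by
    rw [prod_congr rfl fun i _ => quadDen_eq h.d_ne (q ^ (2 * N)) i, prod_mul_distrib, prod_const,
      card_range]
  rw [← mul_right_inj' (pow_ne_zero N h.d_ne), ← mul_assoc, hdd, prod_quadDen]
  unfold quadFactor clearedValue
  have hne : ∏ i ∈ range N, ((d - a * q * q ^ (2 * i)) * (a * q ^ 2 * q ^ (2 * i) - d)) ≠ 0 := by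
    refine prod_ne_zero_iff.2 fun i _ => mul_ne_zero ?_ ?_
    · have := sub_ne_zero.2 (Ne.symm (h.mul_pow_ne_mul_pow (1 + 2 * i) 0))
      convert this using 1; ring
    · have := sub_ne_zero.2 (h.mul_pow_ne_mul_pow (2 + 2 * i) 0)
      convert this using 1; ring
  rw [prod_div_distrib]
  generalize hX : ∏ i ∈ range N, ((d - a * q * q ^ (2 * i)) * (a * q ^ 2 * q ^ (2 * i) - d)) = X at *
  have : ∏ i ∈ range N, ((1 - a * q * q ^ (2 * i)) * (a * q ^ 2 * q ^ (2 * i) - 1) * d) =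
     d ^ N * ∏ i ∈ range N, ((1 - a * q ^ (2 * i + 1)) * (a * q ^ (2 * i + 2) - 1)) := by
    rw [prod_mul_distrib, prod_const, card_range, mul_comm]
    congr 1
    exact prod_congr rfl fun i _ => by ring
  rw [this]
  have h5 : ∏ i ∈ range N, ((1 - a * q ^ (2 * i + 1)) * (a * q ^ (2 * i + 2) - 1) *
    (1 - q ^ (2 * i + 2)) * (1 - a * q * q ^ (2 * N) * q ^ i) * q ^ (2 * i)) =
     (∏ i ∈ range N, ((1 - a * q ^ (2 * i + 1)) * (a * q ^ (2 * i + 2) - 1))) *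
     (∏ i ∈ range N, ((1 - q ^ (2 * i + 2)) * (1 - a * q * q ^ (2 * N) * q ^ i) * q ^ (2 * i))) := by
    rw [← prod_mul_distrib]
    exact prod_congr rfl fun i _ => by ring
  rw [h5]
  field_simp

theorem cubicGeneric_X (hq0 : q ≠ 0) (hq : ∀ i : ℕ, 0 < i → q ^ i ≠ 1) (hd : d ≠ 0) :
    CubicGeneric (algebraMap K[X] (RatFunc K) (C q)) (algebraMap K[X] (RatFunc K) X)
      (algebraMap K[X] (RatFunc K) (C d)) := by
  have inj := RatFunc.algebraMap_injective K
  have inj0 : ∀ p : K[X], p ≠ 0 → algebraMap K[X] (RatFunc K) p ≠ 0 := fun p hp h0 =>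
    hp (inj (by rw [h0, map_zero]))
  refine ⟨inj0 _ (by simpa), inj0 _ X_ne_zero, inj0 _ (by simpa), fun i hi h => hq i hi ?_,
    fun i h => ?_, fun i j h => ?_, fun i h => ?_⟩ <;>
    simp only [← map_pow, ← map_mul, ← map_one (algebraMap K[X] (RatFunc K))] at h <;>
    have h := congrArg (eval 0) (inj h)
  · simpa using h
  · simp at h
  · simp [hd, hq0] at h
  · simp at h
    exact hd h.symm

theorem clearedSum_eq (hq0 : q ≠ 0) (hq : ∀ i : ℕ, 0 < i → q ^ i ≠ 1) (hd : d ≠ 0) (a : K) (N : ℕ) :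
    clearedSum q a (d + a ^ 2 * q * q ^ (2 * N) / d) (q ^ (2 * N)) N =
      clearedValue q a (q ^ (2 * N)) N := by
  have h := clearedSum_of_generic (cubicGeneric_X hq0 hq hd) N
  have e : algebraMap K[X] (RatFunc K) (C d) + algebraMap K[X] (RatFunc K) X ^ 2 *
      algebraMap K[X] (RatFunc K) (C q) * algebraMap K[X] (RatFunc K) (C q) ^ (2 * N) /
      algebraMap K[X] (RatFunc K) (C d) = algebraMap K[X] (RatFunc K)
      (C d + X ^ 2 * C q * C q ^ (2 * N) * C d⁻¹) := by
    have hd' : algebraMap K[X] (RatFunc K) (C d) ≠ 0 := (cubicGeneric_X hq0 hq hd).d_ne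
    have : algebraMap K[X] (RatFunc K) (C d) * algebraMap K[X] (RatFunc K) (C d⁻¹) = 1 := by
      rw [← map_mul, ← C_mul, mul_inv_cancel₀ hd]; simp
    simp only [map_add, map_mul, map_pow]
    rw [eq_inv_of_mul_eq_one_right this, div_eq_mul_inv]
  rw [e, ← map_pow (algebraMap K[X] (RatFunc K)), ← map_clearedSum, ← map_clearedValue] at h
  have h := congrArg (evalRingHom a) (RatFunc.algebraMap_injective K h)
  rw [map_clearedSum, map_clearedValue] at h
  have e' : d + a ^ 2 * q * q ^ (2 * N) / d = d + q * a ^ 2 * q ^ (2 * N) * d⁻¹ := by ring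
  simpa [e'] using h

theorem clearedSum_eq_of_ne_zero (hq0 : q ≠ 0) (hq : ∀ i : ℕ, 0 < i → q ^ i ≠ 1) (ha : a ≠ 0) (W : K)
    (N : ℕ) : clearedSum q a W (q ^ (2 * N)) N = clearedValue q a (q ^ (2 * N)) N := by
  set f := algebraMap K (AlgebraicClosure K)
  have hf : Function.Injective f := f.injective
  obtain ⟨d, hd⟩ := IsAlgClosed.exists_root
    (X ^ 2 - C (f W) * X + C (f (a ^ 2 * q * q ^ (2 * N))) : (AlgebraicClosure K)[X]) (by
      have : (X ^ 2 - C (f W) * X + C (f (a ^ 2 * q * q ^ (2 * N))) : (AlgebraicClosure K)[X]).degree = 2 := by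
        compute_degree!
      rw [this]; decide)
  have hd : d ^ 2 - f W * d + f (a ^ 2 * q * q ^ (2 * N)) = 0 := by simpa [IsRoot] using hd
  have hne : f (a ^ 2 * q * q ^ (2 * N)) ≠ 0 := by
    rw [Ne, map_eq_zero]
    exact mul_ne_zero (mul_ne_zero (pow_ne_zero _ ha) hq0) (pow_ne_zero _ hq0)
  have hd0 : d ≠ 0 := by
    rintro rfl
    apply hne; simpa using hd
  apply hf
  have hW : f W = d + f a ^ 2 * f q * f q ^ (2 * N) / d := by
    field_simp
    simp only [map_mul, map_pow] at hd
    linear_combination -hd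
  rw [map_clearedSum, map_clearedValue, hW, map_pow]
  refine clearedSum_eq ((map_ne_zero f).2 hq0) (fun i hi h => hq i hi (hf ?_)) hd0 _ N
  rw [map_pow, h, map_one]

end CubicSum

section Corner

/-- The term ratio numerator `cubicNum` for `a = q ^ 3 / B`, up to the factor `q * B`. -/
def cornerNum {R : Type*} [CommRing R] (q B w y : R) (i : ℕ) : R :=
  (B - q ^ (i + 3)) * (1 - q ^ (2 * i + 3) * w + q ^ (4 * i + 6) * y) * (y * B ^ 2 - q ^ (2 * i + 1))

/-- The term ratio denominator `cubicDen` for `a = q ^ 3 / B`, up to the factor `q * B`. -/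
def cornerDen {R : Type*} [CommRing R] (q B w y : R) (i : ℕ) : R :=
  (1 - q ^ (2 * i + 2)) * (y * B ^ 2 - q ^ (i + 1) * w * B + q ^ (2 * i + 2)) *
    (1 - q ^ (i + 3) * y * B) * q ^ (i + 3)

/-- The truncated cubic sum in the parameters of `cornerNum` and `cornerDen`. -/
def cornerSum {R : Type*} [CommRing R] [Inv R] (q B w y : R) (M : ℕ) : R :=
  ∑ k ∈ range M, (B - q ^ (3 * k + 3)) *
    ∏ i ∈ range k, (cornerNum q B w y i * (cornerDen q B w y i)⁻¹)

variable {K : Type*} [Field K]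

theorem sum_mul_prod_ratio (c f g : ℕ → K) {N M : ℕ} (hM : N < M) (hf : f N = 0)
    (hg : ∀ i < N, g i ≠ 0) :
    ∑ k ∈ range M, c k * ∏ i ∈ range k, (f i * (g i)⁻¹) =
      (∑ k ∈ range (N + 1), c k * (∏ i ∈ range k, f i) * ∏ i ∈ Ico k N, g i) /
        ∏ i ∈ range N, g i := by
  have h1 : ∑ k ∈ range M, c k * ∏ i ∈ range k, (f i * (g i)⁻¹) =
      ∑ k ∈ range (N + 1), c k * ∏ i ∈ range k, (f i * (g i)⁻¹) := by
    symm
    refine sum_subset (fun x hx => ?_) fun k _ hk => ?_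
    · simp only [mem_range] at *; omega
    · rw [prod_eq_zero (i := N), mul_zero]
      · simp only [mem_range] at *; omega
      · rw [hf, zero_mul]
  rw [h1, sum_div]
  refine sum_congr rfl fun k hk => ?_
  have hk : k ≤ N := by have := mem_range.1 hk; omega
  have hne : ∏ i ∈ range k, g i ≠ 0 :=
    prod_ne_zero_iff.2 fun i hi => hg i (by have := mem_range.1 hi; omega)
  have hne' : ∏ i ∈ Ico k N, g i ≠ 0 :=
    prod_ne_zero_iff.2 fun i hi => hg i (mem_Ico.1 hi).2
  rw [← prod_range_mul_prod_Ico _ hk, prod_mul_distrib, prod_inv_distrib]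
  field_simp

theorem cubicNum_eq_cornerNum {q B : K} (hq : q ≠ 0) (hB : B ≠ 0) (w y : K) (i : ℕ) :
    cornerNum q B w y i = (q * B) * cubicNum q (q ^ 3 / B) (q ^ 3 * w) (y * B ^ 2 / q) i := by
  unfold cornerNum cubicNum
  field_simp
  ring

theorem cubicDen_eq_cornerDen {q B : K} (hB : B ≠ 0) (w y : K) (i : ℕ) :
    cornerDen q B w y i = (q * B) * cubicDen q (q ^ 3 / B) (q ^ 3 * w) (y * B ^ 2 / q) i := by
  unfold cornerDen cubicDen
  field_simp
  ring

/-- The terminating form of `cornerSum`, multiplied by all the denominators `cornerDen`. -/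
def cornerCleared {R : Type*} [CommRing R] (q B w y : R) (N : ℕ) : R :=
  ∑ k ∈ range (N + 1), (B - q ^ (3 * k + 3)) * (∏ i ∈ range k, cornerNum q B w y i) *
    ∏ i ∈ Ico k N, cornerDen q B w y i

theorem map_cornerCleared {R S : Type*} [CommRing R] [CommRing S] (f : R →+* S) (q B w y : R)
    (N : ℕ) : f (cornerCleared q B w y N) = cornerCleared (f q) (f B) (f w) (f y) N := by
  simp [cornerCleared, cornerNum, cornerDen, map_sum, map_prod]

theorem cornerCleared_eq {q B : K} (hq : q ≠ 0) (hB : B ≠ 0) (w y : K) (N : ℕ) :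
    cornerCleared q B w y N =
      (q * B) ^ N * B * clearedSum q (q ^ 3 / B) (q ^ 3 * w) (y * B ^ 2 / q) N := by
  unfold cornerCleared clearedSum
  rw [mul_sum]
  refine sum_congr rfl fun k hk => ?_
  have hk : k ≤ N := by have := mem_range.1 hk; omega
  rw [prod_congr rfl fun i _ => cubicNum_eq_cornerNum hq hB w y i,
    prod_congr rfl fun i _ => cubicDen_eq_cornerDen hB w y i,
    prod_mul_distrib (s := range k), prod_mul_distrib (s := Ico k N), prod_const, prod_const,
    card_range, Nat.card_Ico]
  have : (q * B) ^ N = (q * B) ^ k * (q * B) ^ (N - k) := by rw [← pow_add]; congr 1; omega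
  rw [this]
  have h2 : B - q ^ (3 * k + 3) = B * (1 - q ^ 3 / B * q ^ (3 * k)) := by field_simp; ring
  rw [h2]
  ring

theorem cornerCleared_eq_clearedValue {q B : K} (hq0 : q ≠ 0) (hq : ∀ i : ℕ, 0 < i → q ^ i ≠ 1)
    (hB : B ≠ 0) (w : K) {y : K} (N : ℕ) (hy : y * B ^ 2 = q ^ (2 * N + 1)) :
    cornerCleared q B w y N = (q * B) ^ N * B * clearedValue q (q ^ 3 / B) (q ^ (2 * N)) N := by
  have : y * B ^ 2 / q = q ^ (2 * N) := by rw [hy, pow_succ, mul_div_cancel_right₀ _ hq0]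
  rw [cornerCleared_eq hq0 hB, this,
    clearedSum_eq_of_ne_zero hq0 hq (div_ne_zero (pow_ne_zero _ hq0) hB)]

theorem cornerCleared_split {R : Type*} [CommRing R] {q B w y : R} {m N : ℕ} (hmN : m ≤ N)
    (hB : cornerNum q B w y m = 0) :
    cornerCleared q B w y N = cornerCleared q B w y m * ∏ i ∈ Ico m N, cornerDen q B w y i := by
  unfold cornerCleared
  rw [sum_mul]
  symm
  have : ∀ k ∈ range (m + 1), (B - q ^ (3 * k + 3)) * (∏ i ∈ range k, cornerNum q B w y i) *
      (∏ i ∈ Ico k m, cornerDen q B w y i) * ∏ i ∈ Ico m N, cornerDen q B w y i =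
      (B - q ^ (3 * k + 3)) * (∏ i ∈ range k, cornerNum q B w y i) *
        ∏ i ∈ Ico k N, cornerDen q B w y i := by
    intro k hk
    rw [mul_assoc, prod_Ico_consecutive _ (by have := mem_range.1 hk; omega) hmN]
  rw [sum_congr rfl this]
  refine sum_subset (fun x hx => ?_) fun k _ hk => ?_
  · simp only [mem_range] at *; omega
  · rw [prod_eq_zero (i := m) (by simp only [mem_range] at *; omega) hB, mul_zero, zero_mul]

theorem cornerCleared_special_eq_zero {q : K} (hq0 : q ≠ 0) (hq : ∀ i : ℕ, 0 < i → q ^ i ≠ 1)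
    {m N : ℕ} (hm : Even m) (hm0 : 0 < m) (hN : m ≤ N) (w : K) {y : K}
    (hy : y * (q ^ (m + 3)) ^ 2 = q ^ (2 * N + 1)) :
    cornerCleared q (q ^ (m + 3)) w y m = 0 := by
  have hB : q ^ (m + 3) ≠ 0 := pow_ne_zero _ hq0
  have key : ∀ w : K, cornerCleared q (q ^ (m + 3)) w y N = 0 := by
    intro w
    rw [cornerCleared_eq_clearedValue hq0 hq hB w N hy]
    obtain ⟨r, hr⟩ := hm
    have : clearedValue q (q ^ 3 / q ^ (m + 3)) (q ^ (2 * N)) N = 0 := by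
      unfold clearedValue
      rw [prod_eq_zero (i := r - 1) (by simp only [mem_range]; omega), mul_zero]
      have : q ^ (m + 3) = q ^ 3 * q ^ (2 * (r - 1) + 2) := by
        rw [← pow_add]; congr 1; omega
      have : q ^ 3 / q ^ (m + 3) * q ^ (2 * (r - 1) + 2) - 1 = 0 := by
        rw [this]; field_simp; ring
      rw [this]; ring
    rw [this, mul_zero]
  have hK : Infinite K := by
    refine Infinite.of_injective (fun i : ℕ => q ^ i) fun i j h => ?_
    rcases lt_trichotomy i j with hij | hij | hij
    · exfalso
      apply hq (j - i) (by omega)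
      have h : q ^ i = q ^ j := h
      rw [← mul_right_inj' (pow_ne_zero i hq0), ← pow_add, mul_one, h]; congr 1; omega
    · exact hij
    · exfalso
      apply hq (i - j) (by omega)
      have h : q ^ i = q ^ j := h
      rw [← mul_right_inj' (pow_ne_zero j hq0), ← pow_add, mul_one, ← h]; congr 1; omega
  have hpoly : cornerCleared (C q) (C (q ^ (m + 3))) X (C y) N = 0 := by
    apply Polynomial.funext
    intro w
    have := map_cornerCleared (evalRingHom w) (C q) (C (q ^ (m + 3))) X (C y) N
    simp only [coe_evalRingHom, eval_C, eval_X] at this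
    rw [this, key w, eval_zero]
  rw [cornerCleared_split hN (by simp [cornerNum])] at hpoly
  rcases mul_eq_zero.1 hpoly with h | h
  · have h := congrArg (evalRingHom w) h
    rw [map_cornerCleared] at h
    simpa using h
  · exfalso
    obtain ⟨i, hi, h⟩ := prod_eq_zero_iff.1 h
    have hi := mem_Ico.1 hi
    have hyB : y * q ^ (m + 3) = q ^ (2 * N + 1 - (m + 3)) := by
      rw [← mul_left_inj' hB, ← pow_add, Nat.sub_add_cancel (by omega), ← hy]; ring
    unfold cornerDen at h
    rcases mul_eq_zero.1 h with h | h
    · rcases mul_eq_zero.1 h with h | h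
      · rcases mul_eq_zero.1 h with h | h
        · apply hq (2 * i + 2) (by omega)
          have := congrArg (eval 0) h
          simp at this
          linear_combination -this
        · have h1 := congrArg (eval 1) h
          have h0 := congrArg (eval 0) h
          simp at h1 h0
          have : q ^ (i + 1) * q ^ (m + 3) = 0 := by linear_combination h0 - h1
          exact mul_ne_zero (pow_ne_zero _ hq0) hB this
      · have := congrArg (eval 0) h
        simp [mul_assoc] at this
        rw [hyB, ← pow_add] at this
        exact hq (i + 3 + (2 * N + 1 - (m + 3))) (by omega) (by linear_combination -this)
    · exact hq0 (by simpa using h)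

theorem cornerCleared_eq_zero {q : K} (hq0 : q ≠ 0) (hq : ∀ i : ℕ, 0 < i → q ^ i ≠ 1)
    {m : ℕ} (hm : Even m) (hm0 : 0 < m) (w y : K) :
    cornerCleared q (q ^ (m + 3)) w y m = 0 := by
  have hB : q ^ (m + 3) ≠ 0 := pow_ne_zero _ hq0
  have hp : cornerCleared (C q) (C (q ^ (m + 3))) (C w) X m = 0 := by
    refine Polynomial.eq_zero_of_infinite_isRoot _ ?_
    refine (Set.infinite_range_of_injective
      (f := fun N : ℕ => q ^ (2 * (N + m) + 1) / (q ^ (m + 3)) ^ 2) fun i j h => ?_).mono ?_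
    · have h : q ^ (2 * (i + m) + 1) / (q ^ (m + 3)) ^ 2 = q ^ (2 * (j + m) + 1) / (q ^ (m + 3)) ^ 2 := h
      rw [div_left_inj' (pow_ne_zero _ hB)] at h
      rcases lt_trichotomy i j with hij | hij | hij
      · exfalso
        apply hq (2 * (j + m) + 1 - (2 * (i + m) + 1)) (by omega)
        rw [← mul_right_inj' (pow_ne_zero (2 * (i + m) + 1) hq0), ← pow_add, mul_one, h]; congr 1; omega
      · exact hij
      · exfalso
        apply hq (2 * (i + m) + 1 - (2 * (j + m) + 1)) (by omega)
        rw [← mul_right_inj' (pow_ne_zero (2 * (j + m) + 1) hq0), ← pow_add, mul_one, ← h]; congr 1; omega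
    · rintro _ ⟨N, rfl⟩
      have := map_cornerCleared (evalRingHom (q ^ (2 * (N + m) + 1) / (q ^ (m + 3)) ^ 2))
        (C q) (C (q ^ (m + 3))) (C w) X m
      simp only [coe_evalRingHom, eval_C, eval_X] at this
      show eval _ _ = 0
      rw [this]
      refine cornerCleared_special_eq_zero hq0 hq hm hm0 (N := N + m) (by omega) w ?_
      field_simp
  have h := congrArg (evalRingHom y) hp
  rw [map_cornerCleared] at h
  simpa using h

theorem cornerSum_eq_zero {q : K} (hq0 : q ≠ 0) (hq : ∀ i : ℕ, 0 < i → q ^ i ≠ 1)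
    {m : ℕ} (hm : Even m) (hm0 : 0 < m) (w y : K)
    (hden : ∀ i < m, cornerDen q (q ^ (m + 3)) w y i ≠ 0) :
    cornerSum q (q ^ (m + 3)) w y (m + 1) = 0 := by
  unfold cornerSum
  rw [sum_mul_prod_ratio _ _ _ (Nat.lt_succ_self m) (by simp [cornerNum]) hden]
  have := cornerCleared_eq_zero hq0 hq hm hm0 w y
  unfold cornerCleared at this
  rw [this, zero_div]

theorem cornerSum_eq_div {q : K} (hq0 : q ≠ 0) (hq : ∀ i : ℕ, 0 < i → q ^ i ≠ 1)
    {N M : ℕ} (hM : N < M) : ∃ c : K, ∀ w : K,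
      (∀ i < N, cornerDen q 1 w (q ^ (2 * N + 1)) i ≠ 0) →
      cornerSum q 1 w (q ^ (2 * N + 1)) M =
        c / ∏ i ∈ range N, (q ^ (2 * N + 1) - q ^ (i + 1) * w + q ^ (2 * i + 2)) := by
  refine ⟨(q * 1) ^ N * 1 * clearedValue q (q ^ 3 / 1) (q ^ (2 * N)) N /
    ∏ i ∈ range N, ((1 - q ^ (2 * i + 2)) * (1 - q ^ (i + 3) * q ^ (2 * N + 1)) * q ^ (i + 3)),
    fun w hden => ?_⟩
  unfold cornerSum
  rw [sum_mul_prod_ratio _ _ _ hM (by simp [cornerNum]) hden]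
  rw [← cornerCleared_eq_clearedValue hq0 hq one_ne_zero w (y := q ^ (2 * N + 1)) N (by ring), div_div, ← prod_mul_distrib]
  unfold cornerCleared
  congr 1
  refine prod_congr rfl fun i _ => ?_
  unfold cornerDen
  ring

theorem prod_shift_identity (q : K) (N : ℕ) :
    (1 - q ^ 3) * q ^ N * ∏ i ∈ range N, ((1 - q ^ (2 * i + 4)) * (q ^ (2 * i + 5) - 1) * q ^ i) =
      (1 - q ^ (2 * N + 3)) * ∏ i ∈ range N, ((q ^ (2 * N + 3) - q ^ (i + 1)) * (1 - q ^ (i + 3))) := by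
  have hm : (-1 : K) ^ N = ∏ _i ∈ range N, (-1 : K) := by simp
  have hqN : q ^ N = ∏ _i ∈ range N, q := by simp
  have h1 : ∏ i ∈ range N, ((1 - q ^ (2 * i + 4)) * (q ^ (2 * i + 5) - 1)) =
      (-1) ^ N * ∏ i ∈ range (2 * N), (1 - q ^ (i + 1 + 3)) := by
    rw [← prod_range_two_mul_add_one (fun i => 1 - q ^ (i + 1 + 3)), hm, ← prod_mul_distrib]
    exact prod_congr rfl fun i _ => by ring
  have h2 : ∏ i ∈ range N, (q ^ (2 * N + 3) - q ^ (i + 1)) =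
      (-1) ^ N * (q ^ N * ∏ i ∈ range N, q ^ i) * ∏ i ∈ range N, (1 - q ^ (N + i + 3)) := by
    rw [← prod_range_reflect (fun i => 1 - q ^ (N + i + 3)), hm, hqN]
    rw [← prod_mul_distrib, ← prod_mul_distrib, ← prod_mul_distrib]
    refine prod_congr rfl fun i hi => ?_
    have hi := mem_range.1 hi
    have : q ^ (2 * N + 3) = q ^ i * q * q ^ (N + (N - 1 - i) + 3) := by
      rw [← pow_succ, ← pow_add]; congr 1; omega
    rw [this]; ring
  have h3 : (∏ i ∈ range N, (1 - q ^ (i + 3))) * ∏ i ∈ range N, (1 - q ^ (N + i + 3)) =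
      ∏ i ∈ range (2 * N), (1 - q ^ (i + 3)) := by
    rw [two_mul, prod_range_add]
  have h4 : (1 - q ^ 3) * ∏ i ∈ range (2 * N), (1 - q ^ (i + 1 + 3)) =
      (∏ i ∈ range (2 * N), (1 - q ^ (i + 3))) * (1 - q ^ (2 * N + 3)) := by
    rw [← prod_range_succ, prod_range_succ']; ring
  rw [prod_mul_distrib, prod_mul_distrib (f := fun i => q ^ (2 * N + 3) - q ^ (i + 1)), h1, h2]
  linear_combination ((-1) ^ N * q ^ N * ∏ i ∈ range N, q ^ i) * h4 -
    ((-1) ^ N * q ^ N * (∏ i ∈ range N, q ^ i) * (1 - q ^ (2 * N + 3))) * h3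

theorem cornerSum_eq_linear {q w : K} (hq0 : q ≠ 0) (hq : ∀ i : ℕ, 0 < i → q ^ i ≠ 1)
    {N M : ℕ} (hM : N < M) (hw : w * q ^ (2 * N + 3) = (q ^ (2 * N + 3)) ^ 2 + 1)
    (hden : ∀ i < N, cornerDen q 1 w 1 i ≠ 0) :
    cornerSum q 1 w 1 M * q ^ N = 1 - q ^ (2 * N + 3) := by
  have hY : q ^ (2 * N + 3) ≠ 0 := pow_ne_zero _ hq0
  have hP : q ^ (2 * N) ≠ 0 := pow_ne_zero _ hq0
  have hw' : w = q ^ (2 * N + 3) + (q ^ (2 * N + 3))⁻¹ := by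
    field_simp; linear_combination hw
  have hn : ∀ i, q ^ (2 * N) * cornerNum q 1 w 1 i =
      cubicNum q (q ^ 3) (q + q ^ (2 * N + 6)) (q ^ (2 * N)) i := by
    intro i
    unfold cornerNum cubicNum
    rw [hw']
    field_simp
    ring
  have hd : ∀ i, q ^ (2 * N) * cornerDen q 1 w 1 i =
      cubicDen q (q ^ 3) (q + q ^ (2 * N + 6)) (q ^ (2 * N)) i := by
    intro i
    unfold cornerDen cubicDen
    rw [hw']
    field_simp
    ring
  have hcd : ∀ i < N, cubicDen q (q ^ 3) (q + q ^ (2 * N + 6)) (q ^ (2 * N)) i ≠ 0 :=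
    fun i hi => by rw [← hd]; exact mul_ne_zero hP (hden i hi)
  have hs : cornerSum q 1 w 1 M = ∑ k ∈ range M, (1 - q ^ (3 * k + 3)) *
      ∏ i ∈ range k, (cubicNum q (q ^ 3) (q + q ^ (2 * N + 6)) (q ^ (2 * N)) i *
        (cubicDen q (q ^ 3) (q + q ^ (2 * N + 6)) (q ^ (2 * N)) i)⁻¹) := by
    unfold cornerSum
    refine sum_congr rfl fun k _ => ?_
    congr 1
    refine prod_congr rfl fun i _ => ?_
    rw [← hn, ← hd, mul_inv]
    field_simp
  rw [hs, sum_mul_prod_ratio _ _ _ hM (by simp [cubicNum]) hcd]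
  have h := clearedSum_eq_of_ne_zero hq0 hq (pow_ne_zero 3 hq0) (q + q ^ (2 * N + 6)) N
  unfold clearedSum at h
  have h' : ∀ k, 1 - q ^ (3 * k + 3) = 1 - q ^ 3 * q ^ (3 * k) := fun k => by ring
  simp only [h']
  rw [h, div_mul_eq_mul_div, div_eq_iff (prod_ne_zero_iff.2 fun i hi => hcd i (mem_range.1 hi))]
  unfold clearedValue
  have e1 : ∏ i ∈ range N, ((1 - q ^ 3 * q ^ (2 * i + 1)) * (q ^ 3 * q ^ (2 * i + 2) - 1) *
      (1 - q ^ (2 * i + 2)) * (1 - q ^ 3 * q * q ^ (2 * N) * q ^ i) * q ^ (2 * i)) =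
      (∏ i ∈ range N, ((1 - q ^ (2 * i + 4)) * (q ^ (2 * i + 5) - 1) * q ^ i)) *
      ∏ i ∈ range N, ((1 - q ^ (2 * i + 2)) * (1 - q ^ (2 * N + 4 + i)) * q ^ i) := by
    rw [← prod_mul_distrib]; exact prod_congr rfl fun i _ => by ring
  have e2 : ∏ i ∈ range N, cubicDen q (q ^ 3) (q + q ^ (2 * N + 6)) (q ^ (2 * N)) i =
      (∏ i ∈ range N, ((q ^ (2 * N + 3) - q ^ (i + 1)) * (1 - q ^ (i + 3)))) *
      ∏ i ∈ range N, ((1 - q ^ (2 * i + 2)) * (1 - q ^ (2 * N + 4 + i)) * q ^ i) := by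
    rw [← prod_mul_distrib]
    refine prod_congr rfl fun i _ => ?_
    unfold cubicDen; ring
  rw [e1, e2]
  linear_combination (∏ i ∈ range N, ((1 - q ^ (2 * i + 2)) * (1 - q ^ (2 * N + 4 + i)) * q ^ i)) *
    prod_shift_identity q N

end Corner

section Pair
variable {R : Type*} [CommRing R]

/-- Pairs of elements of `S`, indexed by `Bool`, that are congruent modulo `δ` in `S`. -/
def pairSubring (S : Subring R) (δ : S) : Subring (Bool → R) where
  carrier := {f | f false ∈ S ∧ ∃ u ∈ S, f true = f false + δ * u}
  mul_mem' := by
    rintro f g ⟨hf, u, hu, hfu⟩ ⟨hg, v, hv, hgv⟩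
    refine ⟨S.mul_mem hf hg, f false * v + u * g false + δ * u * v, ?_, ?_⟩
    · exact S.add_mem (S.add_mem (S.mul_mem hf hv) (S.mul_mem hu hg))
        (S.mul_mem (S.mul_mem δ.2 hu) hv)
    · simp only [Pi.mul_apply, hfu, hgv]; ring
  one_mem' := ⟨S.one_mem, 0, S.zero_mem, by simp⟩
  add_mem' := by
    rintro f g ⟨hf, u, hu, hfu⟩ ⟨hg, v, hv, hgv⟩
    refine ⟨S.add_mem hf hg, u + v, S.add_mem hu hv, ?_⟩
    simp only [Pi.add_apply, hfu, hgv]; ring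
  zero_mem' := ⟨S.zero_mem, 0, S.zero_mem, by simp⟩
  neg_mem' := by
    rintro f ⟨hf, u, hu, hfu⟩
    refine ⟨S.neg_mem hf, -u, S.neg_mem hu, ?_⟩
    simp only [Pi.neg_apply, hfu]; ring

theorem const_mem_pairSubring {S : Subring R} (δ : S) {c : R} (hc : c ∈ S) :
    (fun _ => c) ∈ pairSubring S δ :=
  ⟨hc, 0, S.zero_mem, by simp⟩

theorem bool_mem_pairSubring {S : Subring R} {δ : S} {c d : R} (hc : c ∈ S) (h : d = c + δ) :
    (fun b : Bool => if b then d else c) ∈ pairSubring S δ :=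
  ⟨by simpa using hc, 1, S.one_mem, by simpa using h⟩

theorem inv_mem_pairSubring [Inv R] {S : Subring R} {δ : S} {f : Bool → R}
    (hf : f ∈ pairSubring S δ) (h1 : ∀ b, f b * (f b)⁻¹ = 1) (h2 : ∀ b, (f b)⁻¹ ∈ S) :
    f⁻¹ ∈ pairSubring S δ := by
  obtain ⟨_, u, hu, hfu⟩ := hf
  refine ⟨h2 false, -(u * (f true)⁻¹ * (f false)⁻¹),
    S.neg_mem (S.mul_mem (S.mul_mem hu (h2 true)) (h2 false)), ?_⟩
  have a := h1 true
  have b := h1 false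
  simp only [Pi.inv_apply]
  linear_combination (-(f true)⁻¹) * b + (f false)⁻¹ * a - (f true)⁻¹ * (f false)⁻¹ * hfu

end Pair

section Cube
variable {K : Type*} [Field K]

theorem cornerSum_apply {R : Type*} [CommRing R] [Inv R] {ι : Type*} (q B w y : ι → R) (M : ℕ)
    (b : ι) : cornerSum q B w y M b = cornerSum (q b) (B b) (w b) (y b) M := by
  simp [cornerSum, cornerNum, cornerDen, Finset.sum_apply, Finset.prod_apply]

theorem cornerSum_mem {R : Type*} [CommRing R] [Inv R] {S : Subring R} {q B w y : R} {M : ℕ}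
    (hq : q ∈ S) (hB : B ∈ S) (hw : w ∈ S) (hy : y ∈ S)
    (h : ∀ i < M, (cornerDen q B w y i)⁻¹ ∈ S) : cornerSum q B w y (M + 1) ∈ S := by
  refine S.sum_mem fun k hk => S.mul_mem (S.sub_mem hB (S.pow_mem hq _)) (S.prod_mem fun i hi => ?_)
  refine S.mul_mem (S.mul_mem (S.mul_mem (S.sub_mem hB (S.pow_mem hq _)) ?_) ?_) (h i ?_)
  · exact S.add_mem (S.sub_mem S.one_mem (S.mul_mem (S.pow_mem hq _) hw))
      (S.mul_mem (S.pow_mem hq _) hy)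
  · exact S.sub_mem (S.mul_mem hy (S.pow_mem hB _)) (S.pow_mem hq _)
  · simp only [mem_range] at *; omega

theorem cornerDen_mem {R : Type*} [CommRing R] {S : Subring R} {q B w y : R}
    (hq : q ∈ S) (hB : B ∈ S) (hw : w ∈ S) (hy : y ∈ S) (i : ℕ) : cornerDen q B w y i ∈ S := by
  refine S.mul_mem (S.mul_mem (S.mul_mem (S.sub_mem S.one_mem (S.pow_mem hq _)) ?_) ?_)
    (S.pow_mem hq _)
  · exact S.add_mem (S.sub_mem (S.mul_mem hy (S.pow_mem hB _))
      (S.mul_mem (S.mul_mem (S.pow_mem hq _) hw) hB)) (S.pow_mem hq _)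
  · exact S.sub_mem S.one_mem (S.mul_mem (S.mul_mem (S.pow_mem hq _) hy) hB)

theorem cornerSum_cube (O : Subring K) {q Y w₀ w₁ : K} {M : ℕ} (hq : q ∈ O) (hY : Y ∈ O)
    (hw₀ : w₀ ∈ O) (hw₁ : w₁ ∈ O)
    (hne : ∀ i < M, ∀ b c e : Bool, cornerDen q (if b then Y else 1) (if c then w₁ else w₀)
      (if e then Y else 1) i ≠ 0)
    (hinv : ∀ i < M, ∀ b c e : Bool, (cornerDen q (if b then Y else 1) (if c then w₁ else w₀)
      (if e then Y else 1) i)⁻¹ ∈ O)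
    (hzero : ∀ c e : Bool, cornerSum q Y (if c then w₁ else w₀) (if e then Y else 1) (M + 1) = 0) :
    (∃ u ∈ O, cornerSum q 1 w₀ 1 (M + 1) = cornerSum q 1 w₁ 1 (M + 1) + (Y - 1) * (w₁ - w₀) * u) ∧
    (∃ u ∈ O, cornerSum q 1 w₀ 1 (M + 1) = cornerSum q 1 w₀ Y (M + 1) + (Y - 1) ^ 2 * u) ∧
    (∃ u ∈ O, cornerSum q 1 w₀ 1 (M + 1) - cornerSum q 1 w₁ 1 (M + 1) -
      cornerSum q 1 w₀ Y (M + 1) + cornerSum q 1 w₁ Y (M + 1) = (Y - 1) ^ 2 * (w₁ - w₀) * u) := by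
  let δ₁ : O := ⟨Y - 1, O.sub_mem hY O.one_mem⟩
  let S₁ := pairSubring O δ₁
  let δ₂ : S₁ := ⟨fun _ => w₁ - w₀, const_mem_pairSubring _ (O.sub_mem hw₁ hw₀)⟩
  let S₂ := pairSubring S₁ δ₂
  let δ₃ : S₂ := ⟨fun _ _ => Y - 1, const_mem_pairSubring _ (const_mem_pairSubring _ δ₁.2)⟩
  let S₃ := pairSubring S₂ δ₃
  let qf : Bool → Bool → Bool → K := fun _ _ _ => q
  let Bf : Bool → Bool → Bool → K := fun b => if b then (fun _ _ => Y) else 1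
  let wf : Bool → Bool → Bool → K := fun _ c => if c then (fun _ => w₁) else fun _ => w₀
  let yf : Bool → Bool → Bool → K := fun _ _ e => if e then Y else 1
  have hqf : qf ∈ S₃ :=
    const_mem_pairSubring _ (const_mem_pairSubring _ (const_mem_pairSubring _ hq))
  have hBf : Bf ∈ S₃ := by
    refine bool_mem_pairSubring S₂.one_mem ?_
    ext; simp [δ₃]
  have hwf : wf ∈ S₃ := by
    refine const_mem_pairSubring _ (bool_mem_pairSubring (const_mem_pairSubring _ hw₀) ?_)
    ext; simp [δ₂]
  have hyf : yf ∈ S₃ := by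
    refine const_mem_pairSubring _ (const_mem_pairSubring _ (bool_mem_pairSubring O.one_mem ?_))
    simp [δ₁]
  have hD : ∀ i b c e, cornerDen qf Bf wf yf i b c e =
      cornerDen q (if b then Y else 1) (if c then w₁ else w₀) (if e then Y else 1) i := by
    intro i b c e
    cases b <;> cases c <;> simp [cornerDen, qf, Bf, wf, yf]
  have hDmem : ∀ i, cornerDen qf Bf wf yf i ∈ S₃ := cornerDen_mem hqf hBf hwf hyf
  have hV : ∀ b c e, cornerSum qf Bf wf yf (M + 1) b c e =
      cornerSum q (if b then Y else 1) (if c then w₁ else w₀) (if e then Y else 1) (M + 1) := by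
    intro b c e
    rw [cornerSum_apply, cornerSum_apply, cornerSum_apply]
    cases b <;> cases c <;> simp [qf, Bf, wf, yf]
  have hmem : cornerSum qf Bf wf yf (M + 1) ∈ S₃ := by
    refine cornerSum_mem hqf hBf hwf hyf fun i hi => ?_
    have hmul : ∀ b c e, cornerDen qf Bf wf yf i b c e * (cornerDen qf Bf wf yf i b c e)⁻¹ = 1 := by
      intro b c e
      rw [hD]
      exact mul_inv_cancel₀ (hne i hi b c e)
    have hval : ∀ f ∈ S₃, ∀ b, f b ∈ S₂ := by
      rintro f ⟨h0, u, hu, h1⟩ b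
      cases b
      · exact h0
      · rw [h1]; exact S₂.add_mem h0 (S₂.mul_mem δ₃.2 hu)
    have hval' : ∀ f ∈ S₂, ∀ b, f b ∈ S₁ := by
      rintro f ⟨h0, u, hu, h1⟩ b
      cases b
      · exact h0
      · rw [h1]; exact S₁.add_mem h0 (S₁.mul_mem δ₂.2 hu)
    refine inv_mem_pairSubring (hDmem i) (fun b => funext fun c => funext fun e => hmul b c e)
      fun b => ?_
    refine inv_mem_pairSubring (hval _ (hDmem i) b) (fun c => funext fun e => hmul b c e)
      fun c => ?_
    refine inv_mem_pairSubring (hval' _ (hval _ (hDmem i) b) c) (fun e => hmul b c e)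
      fun e => ?_
    rw [hD]
    exact hinv i hi b c e
  obtain ⟨-, u, ⟨⟨hu00, t', ht', hu0⟩, v, ⟨hv0, t, ht, hv⟩, hu⟩, hF⟩ := hmem
  have F := fun c e => congrFun (congrFun hF c) e
  simp only [Pi.add_apply, Pi.mul_apply, hV] at F
  have Fff := F false false
  have Ffe := F false true
  have Fcf := F true false
  have Fce := F true true
  have z := hzero
  have zff := z false false
  have zfe := z false true
  have zcf := z true false
  have zce := z true true
  simp only [if_true, if_false, Bool.false_eq_true] at Fff Ffe Fcf Fce zff zfe zcf zce
  rw [zff] at Fff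
  rw [zfe] at Ffe
  rw [zcf] at Fcf
  rw [zce] at Fce
  have huf := congrFun hu false
  have hut := congrFun hu true
  simp only [Pi.add_apply, Pi.mul_apply] at huf hut
  have e1 : ((δ₁ : O) : K) = Y - 1 := rfl
  have e2 : ∀ e, ((δ₂ : S₁) : Bool → K) e = w₁ - w₀ := fun _ => rfl
  have e3 : ∀ c e, ((δ₃ : S₂) : Bool → Bool → K) c e = Y - 1 := fun _ _ => rfl
  simp only [e1, e2, e3] at hu0 hv huf hut Fff Ffe Fcf Fce
  refine ⟨⟨v false, hv0, ?_⟩, ⟨t', ht', ?_⟩, ⟨-t, O.neg_mem ht, ?_⟩⟩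
  · linear_combination Fcf - Fff + (Y - 1) * huf
  · linear_combination Ffe - Fff + (Y - 1) * hu0
  · linear_combination Ffe - Fff + Fcf - Fce - (Y - 1) * hut + (Y - 1) * huf -
      (Y - 1) * (w₁ - w₀) * hv

end Cube

section Value

/-- The rational function `x` is defined at `ζ`, with value `c`. -/
def HasValueAt (ζ : ℂ) (x : RatFunc ℚ) (c : ℂ) : Prop :=
  Polynomial.eval₂ (algebraMap ℚ ℂ) ζ x.denom ≠ 0 ∧ RatFunc.eval (algebraMap ℚ ℂ) ζ x = c

namespace HasValueAt
variable {ζ : ℂ} {x y : RatFunc ℚ} {c d : ℂ}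

theorem unique (hx : HasValueAt ζ x c) (hy : HasValueAt ζ x d) : c = d := hx.2.symm.trans hy.2

theorem congr (hx : HasValueAt ζ x c) (h : c = d) : HasValueAt ζ x d := h ▸ hx

theorem poly (ζ : ℂ) (p : ℚ[X]) : HasValueAt ζ (algebraMap ℚ[X] (RatFunc ℚ) p) (aeval ζ p) :=
  ⟨by simp, by rw [RatFunc.eval_algebraMap]; rfl⟩

theorem denom_dvd {a b : ℚ[X]} (h : a ∣ b) (hb : Polynomial.eval₂ (algebraMap ℚ ℂ) ζ b ≠ 0) :
    Polynomial.eval₂ (algebraMap ℚ ℂ) ζ a ≠ 0 := fun h0 =>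
  hb (Polynomial.eval₂_eq_zero_of_dvd_of_eval₂_eq_zero _ _ h h0)

theorem add (hx : HasValueAt ζ x c) (hy : HasValueAt ζ y d) : HasValueAt ζ (x + y) (c + d) :=
  ⟨denom_dvd (RatFunc.denom_add_dvd x y) (by rw [eval₂_mul]; exact mul_ne_zero hx.1 hy.1),
    by rw [RatFunc.eval_add _ _ hx.1 hy.1, hx.2, hy.2]⟩

theorem mul (hx : HasValueAt ζ x c) (hy : HasValueAt ζ y d) : HasValueAt ζ (x * y) (c * d) :=
  ⟨denom_dvd (RatFunc.denom_mul_dvd x y) (by rw [eval₂_mul]; exact mul_ne_zero hx.1 hy.1),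
    by rw [RatFunc.eval_mul _ _ hx.1 hy.1, hx.2, hy.2]⟩

theorem natCast (ζ : ℂ) (n : ℕ) : HasValueAt ζ (n : RatFunc ℚ) n := by
  simpa using poly ζ (n : ℚ[X])

theorem one (ζ : ℂ) : HasValueAt ζ 1 1 := by simpa using natCast ζ 1

theorem zero (ζ : ℂ) : HasValueAt ζ 0 0 := by simpa using natCast ζ 0

theorem ofNat (ζ : ℂ) (n : ℕ) [n.AtLeastTwo] :
    HasValueAt ζ (OfNat.ofNat n : RatFunc ℚ) (OfNat.ofNat n) := natCast ζ n

theorem neg (hx : HasValueAt ζ x c) : HasValueAt ζ (-x) (-c) := by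
  have h : HasValueAt ζ (-1) (-1) := by simpa using poly ζ (-1)
  simpa using h.mul hx

theorem sub (hx : HasValueAt ζ x c) (hy : HasValueAt ζ y d) : HasValueAt ζ (x - y) (c - d) := by
  simpa [sub_eq_add_neg] using hx.add hy.neg

theorem pow (hx : HasValueAt ζ x c) (n : ℕ) : HasValueAt ζ (x ^ n) (c ^ n) := by
  induction n with
  | zero => simpa using one ζ
  | succ n ih => rw [pow_succ, pow_succ]; exact ih.mul hx

theorem sum {ι : Type*} (s : Finset ι) {f : ι → RatFunc ℚ} {g : ι → ℂ}
    (h : ∀ i ∈ s, HasValueAt ζ (f i) (g i)) : HasValueAt ζ (∑ i ∈ s, f i) (∑ i ∈ s, g i) := by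
  classical
  induction s using Finset.induction_on with
  | empty => simpa using zero ζ
  | insert a s ha ih =>
    rw [sum_insert ha, sum_insert ha]
    exact (h a (mem_insert_self a s)).add (ih fun i hi => h i (mem_insert_of_mem hi))

theorem prod {ι : Type*} (s : Finset ι) {f : ι → RatFunc ℚ} {g : ι → ℂ}
    (h : ∀ i ∈ s, HasValueAt ζ (f i) (g i)) : HasValueAt ζ (∏ i ∈ s, f i) (∏ i ∈ s, g i) := by
  classical
  induction s using Finset.induction_on with
  | empty => simpa using one ζ
  | insert a s ha ih =>
    rw [prod_insert ha, prod_insert ha]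
    exact (h a (mem_insert_self a s)).mul (ih fun i hi => h i (mem_insert_of_mem hi))

theorem ne_zero (hx : HasValueAt ζ x c) (hc : c ≠ 0) : x ≠ 0 := by
  rintro rfl
  exact hc (hx.unique (zero ζ))

theorem inv (hx : HasValueAt ζ x c) (hc : c ≠ 0) : HasValueAt ζ x⁻¹ c⁻¹ := by
  have h0 := hx.ne_zero hc
  have hn : Polynomial.eval₂ (algebraMap ℚ ℂ) ζ x.num ≠ 0 := by
    intro h
    apply hc
    rw [← hx.2, RatFunc.eval, h, zero_div]
  have h1 : HasValueAt ζ x⁻¹ (RatFunc.eval (algebraMap ℚ ℂ) ζ x⁻¹) :=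
    ⟨denom_dvd (RatFunc.denom_inv_dvd h0) hn, rfl⟩
  refine h1.congr (eq_inv_of_mul_eq_one_right ?_)
  have := hx.mul h1
  rw [mul_inv_cancel₀ h0] at this
  exact this.unique (one ζ)

theorem div (hx : HasValueAt ζ x c) (hy : HasValueAt ζ y d) (hd : d ≠ 0) :
    HasValueAt ζ (x / y) (c / d) := by
  rw [div_eq_mul_inv, div_eq_mul_inv]; exact hx.mul (hy.inv hd)

theorem q (ζ : ℂ) : HasValueAt ζ q ζ := by
  have := poly ζ X
  rw [RatFunc.algebraMap_X] at this
  simpa [_root_.q] using this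

end HasValueAt

/-- The rational functions that are defined at `ζ`. -/
def regularAt (ζ : ℂ) : Subring (RatFunc ℚ) where
  carrier := {x | ∃ c, HasValueAt ζ x c}
  mul_mem' := fun ⟨_, hx⟩ ⟨_, hy⟩ => ⟨_, hx.mul hy⟩
  one_mem' := ⟨_, HasValueAt.one ζ⟩
  add_mem' := fun ⟨_, hx⟩ ⟨_, hy⟩ => ⟨_, hx.add hy⟩
  zero_mem' := ⟨_, HasValueAt.zero ζ⟩
  neg_mem' := fun ⟨_, hx⟩ => ⟨_, hx.neg⟩

theorem HasValueAt.mem {ζ : ℂ} {x : RatFunc ℚ} {c : ℂ} (h : HasValueAt ζ x c) : x ∈ regularAt ζ :=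
  ⟨c, h⟩

/-- The cyclotomic polynomial as a rational function. -/
noncomputable def cycl (n : ℕ) : RatFunc ℚ := algebraMap ℚ[X] (RatFunc ℚ) (cyclotomic n ℚ)

theorem hasValueAt_cycl {ζ : ℂ} {n : ℕ} (hζ : IsPrimitiveRoot ζ n) (hn : 0 < n) :
    HasValueAt ζ (cycl n) 0 := by
  refine (HasValueAt.poly ζ _).congr ?_
  rw [cyclotomic_eq_minpoly_rat hζ hn, minpoly.aeval]

theorem HasValueAt.exists_eq_mul {ζ : ℂ} {n : ℕ} (hζ : IsPrimitiveRoot ζ n) (hn : 0 < n)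
    {x : RatFunc ℚ} (h : HasValueAt ζ x 0) : ∃ u ∈ regularAt ζ, x = cycl n * u := by
  obtain ⟨h1, h2⟩ := h
  have h3 : aeval ζ x.num = 0 := by
    rw [RatFunc.eval, div_eq_zero_iff] at h2
    exact h2.resolve_right h1
  have h4 := minpoly.dvd ℚ ζ h3
  rw [← cyclotomic_eq_minpoly_rat hζ hn] at h4
  obtain ⟨r, hr⟩ := h4
  refine ⟨algebraMap ℚ[X] (RatFunc ℚ) r / algebraMap ℚ[X] (RatFunc ℚ) x.denom,
    ((HasValueAt.poly ζ r).div (HasValueAt.poly ζ x.denom) h1).mem, ?_⟩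
  rw [mul_div_assoc', cycl, ← map_mul, ← hr, RatFunc.num_div_denom]

theorem pow_dvd_num {ζ : ℂ} {n : ℕ} (hζ : IsPrimitiveRoot ζ n) (hn : 0 < n)
    {x u : RatFunc ℚ} (hu : u ∈ regularAt ζ) (m : ℕ) (h : x = cycl n ^ m * u) :
    cyclotomic n ℚ ^ m ∣ x.num := by
  obtain ⟨c, hc⟩ := hu
  have hcop : IsCoprime (cyclotomic n ℚ ^ m) u.denom := by
    refine IsCoprime.pow_left ?_
    rw [(cyclotomic.irreducible_rat hn).coprime_iff_not_dvd]
    rintro ⟨r, hr⟩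
    apply hc.1
    have h0 : aeval ζ (cyclotomic n ℚ) = 0 := by
      rw [cyclotomic_eq_minpoly_rat hζ hn, minpoly.aeval]
    have : aeval ζ u.denom = 0 := by rw [hr, map_mul, h0, zero_mul]
    exact this
  refine hcop.dvd_of_dvd_mul_right (Dvd.intro (u.num * x.denom) ?_)
  apply RatFunc.algebraMap_injective ℚ
  have e1 := RatFunc.num_div_denom x
  have e2 := RatFunc.num_div_denom u
  have n1 : algebraMap ℚ[X] (RatFunc ℚ) x.denom ≠ 0 := by
    rw [Ne, map_eq_zero_iff _ (RatFunc.algebraMap_injective ℚ)]; exact x.denom_ne_zero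
  have n2 : algebraMap ℚ[X] (RatFunc ℚ) u.denom ≠ 0 := by
    rw [Ne, map_eq_zero_iff _ (RatFunc.algebraMap_injective ℚ)]; exact u.denom_ne_zero
  rw [div_eq_iff n1] at e1
  rw [div_eq_iff n2] at e2
  simp only [map_mul, map_pow]
  rw [e1, e2, h, cycl]
  ring

theorem q_pow_ne_one (i : ℕ) (hi : 0 < i) : q ^ i ≠ 1 := by
  have h := (HasValueAt.q 2).pow i
  intro h1
  rw [h1] at h
  have := h.unique (HasValueAt.one 2)
  have h2 : (2 : ℕ) ^ i = 1 := by exact_mod_cast this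
  have := Nat.one_lt_two_pow (n := i) (by omega)
  omega

theorem q_ne_zero : q ≠ 0 := (HasValueAt.q 2).ne_zero two_ne_zero

end Value

section RootSum
variable {K : Type*} [Field K]

theorem sum_weighted_pow {z : K} {n : ℕ} (hz : z ^ n = 1) (hz1 : z ≠ 1) :
    (1 - z) ^ 2 * ∑ j ∈ range n, (j * (n - j) : K) * z ^ j = 2 * n * z := by
  have h0 : ∑ j ∈ range n, z ^ j = 0 := by
    rw [geom_sum_eq hz1, hz, sub_self, zero_div]
  have h1 : ∀ k : ℕ, (1 - z) * ∑ j ∈ range k, (j : K) * z ^ j =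
      z * ∑ j ∈ range k, z ^ j - k * z ^ k := by
    intro k
    induction k with
    | zero => simp
    | succ k ih =>
      rw [sum_range_succ, sum_range_succ, mul_add, ih]; push_cast; ring
  have h2 : ∀ k : ℕ, (1 - z) * ∑ j ∈ range k, (j : K) ^ 2 * z ^ j =
      z * (2 * ∑ j ∈ range k, (j : K) * z ^ j + ∑ j ∈ range k, z ^ j) - k ^ 2 * z ^ k := by
    intro k
    induction k with
    | zero => simp
    | succ k ih =>
      rw [sum_range_succ, sum_range_succ, sum_range_succ (fun j => z ^ j), mul_add, ih]
      push_cast; ring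
  have h3 : ∑ j ∈ range n, (j * (n - j) : K) * z ^ j =
      n * ∑ j ∈ range n, (j : K) * z ^ j - ∑ j ∈ range n, (j : K) ^ 2 * z ^ j := by
    rw [mul_sum, ← sum_sub_distrib]
    exact sum_congr rfl fun j _ => by ring
  have a := h1 n
  have b := h2 n
  rw [hz, h0] at a b
  rw [h3]
  linear_combination ((1 - z) * n - 2 * z) * a - (1 - z) * b

theorem sum_range_mul_sub (n : ℕ) :
    6 * ∑ j ∈ range n, (j * (n - j) : K) = n * (n ^ 2 - 1) := by
  have h : ∀ (m : K) (k : ℕ), 6 * ∑ j ∈ range k, (j * (m - j) : K) =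
      k * (k - 1) * (3 * m - 2 * k + 1) := by
    intro m k
    induction k with
    | zero => simp
    | succ k ih => rw [sum_range_succ, mul_add, ih]; push_cast; ring
  rw [h]; ring

theorem sum_root_div_sq [CharZero K] {ζ : K} {N : ℕ} (hζ : IsPrimitiveRoot ζ (2 * N + 1)) :
    ∑ i ∈ range N, ζ ^ (i + 1) / (1 - ζ ^ (i + 1)) ^ 2 = -(((2 * N + 1 : ℕ) : K) ^ 2 - 1) / 24 := by
  set n := 2 * N + 1 with hn
  have hn0 : (n : K) ≠ 0 := by rw [hn]; exact Nat.cast_ne_zero.2 (Nat.succ_ne_zero (2 * N))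
  have hne : ∀ e, e + 1 < n → ζ ^ (e + 1) ≠ 1 := fun e he =>
    hζ.pow_ne_one_of_pos_of_lt (Nat.succ_ne_zero _) he
  have hζ0 : ζ ≠ 0 := hζ.ne_zero (by omega)
  have key : ∀ e ∈ range (2 * N), ζ ^ (e + 1) / (1 - ζ ^ (e + 1)) ^ 2 =
      (2 * n : K)⁻¹ * ∑ j ∈ range n, (j * (n - j) : K) * (ζ ^ (e + 1)) ^ j := by
    intro e he
    have h1 := hne e (by simp at he; omega)
    have := sum_weighted_pow (z := ζ ^ (e + 1)) (n := n)
      (by rw [← pow_mul, mul_comm, pow_mul, hζ.pow_eq_one, one_pow]) h1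
    have h2 : 1 - ζ ^ (e + 1) ≠ 0 := sub_ne_zero.2 (Ne.symm h1)
    field_simp
    rw [mul_comm, this]; ring
  have hfull : ∑ e ∈ range (2 * N), ζ ^ (e + 1) / (1 - ζ ^ (e + 1)) ^ 2 =
      -((n : K) ^ 2 - 1) / 12 := by
    rw [sum_congr rfl key, ← mul_sum, sum_comm]
    have : ∀ j ∈ range n, ∑ e ∈ range (2 * N), (j * (n - j) : K) * (ζ ^ (e + 1)) ^ j =
        -(j * (n - j) : K) := by
      intro j hj
      rw [← mul_sum]
      rcases Nat.eq_zero_or_pos j with rfl | hj0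
      · simp
      have h1 : ζ ^ j ≠ 1 := hζ.pow_ne_one_of_pos_of_lt hj0.ne' (mem_range.1 hj)
      have h2 : ∑ e ∈ range n, (ζ ^ j) ^ e = 0 := by
        rw [geom_sum_eq h1, ← pow_mul, mul_comm, pow_mul, hζ.pow_eq_one, one_pow, sub_self,
          zero_div]
      rw [hn, sum_range_succ'] at h2
      have h3 : ∑ e ∈ range (2 * N), (ζ ^ (e + 1)) ^ j = -1 := by
        rw [← sub_eq_zero, ← h2]
        simp only [pow_zero, sub_neg_eq_add]
        congr 1
        exact sum_congr rfl fun e _ => by rw [← pow_mul, ← pow_mul, mul_comm]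
      rw [h3]; ring
    rw [sum_congr rfl this, sum_neg_distrib]
    have h6 := sum_range_mul_sub (K := K) n
    field_simp
    linear_combination (-2) * h6
  have hsym : ∑ i ∈ range N, ζ ^ (N + i + 1) / (1 - ζ ^ (N + i + 1)) ^ 2 =
      ∑ i ∈ range N, ζ ^ (i + 1) / (1 - ζ ^ (i + 1)) ^ 2 := by
    rw [← sum_range_reflect]
    refine sum_congr rfl fun i hi => ?_
    have hi := mem_range.1 hi
    have hm : ζ ^ (N + (N - 1 - i) + 1) * ζ ^ (i + 1) = 1 := by
      rw [← pow_add, show N + (N - 1 - i) + 1 + (i + 1) = n by omega, hζ.pow_eq_one]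
    have ha : 1 - ζ ^ (i + 1) ≠ 0 := sub_ne_zero.2 (Ne.symm (hne _ (by omega)))
    have hb : 1 - ζ ^ (N + (N - 1 - i) + 1) ≠ 0 := sub_ne_zero.2 (Ne.symm (hne _ (by omega)))
    rw [div_eq_div_iff (pow_ne_zero _ hb) (pow_ne_zero _ ha)]
    linear_combination (ζ ^ (i + 1) - ζ ^ (N + (N - 1 - i) + 1)) * hm
  rw [two_mul, sum_range_add] at hfull
  simp only [hsym] at hfull
  linear_combination hfull / 2

theorem prod_one_add_mul {R ι : Type*} [CommRing R] (O : Subring R) (s : Finset ι) {t : R}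
    (ht : t ∈ O) {c : ι → R} (hc : ∀ i ∈ s, c i ∈ O) :
    ∃ u ∈ O, ∏ i ∈ s, (1 + c i * t) = 1 + t * ∑ i ∈ s, c i + t ^ 2 * u := by
  classical
  induction s using Finset.induction_on with
  | empty => exact ⟨0, O.zero_mem, by simp⟩
  | insert a s ha ih =>
    obtain ⟨u, hu, h⟩ := ih fun i hi => hc i (mem_insert_of_mem hi)
    have hca := hc a (mem_insert_self a s)
    refine ⟨u + c a * ∑ i ∈ s, c i + t * c a * u, ?_, ?_⟩
    · exact O.add_mem (O.add_mem hu (O.mul_mem hca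
        (O.sum_mem fun i hi => hc i (mem_insert_of_mem hi)))) (O.mul_mem (O.mul_mem ht hca) hu)
    · rw [prod_insert ha, sum_insert ha, h]; ring

end RootSum

section Local

theorem hasValueAt_cornerDen {ζ : ℂ} {B w y : RatFunc ℚ} (hB : HasValueAt ζ B 1)
    (hw : HasValueAt ζ w 2) (hy : HasValueAt ζ y 1) (i : ℕ) :
    HasValueAt ζ (cornerDen q B w y i)
      ((1 - ζ ^ (2 * i + 2)) * (1 - ζ ^ (i + 1)) ^ 2 * (1 - ζ ^ (i + 3)) * ζ ^ (i + 3)) := by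
  have hq := HasValueAt.q ζ
  have h1 := HasValueAt.one ζ
  refine HasValueAt.congr ((((h1.sub (hq.pow _)).mul (((hy.mul (hB.pow 2)).sub
    (((hq.pow _).mul hw).mul hB)).add (hq.pow _))).mul
      (h1.sub (((hq.pow _).mul hy).mul hB))).mul (hq.pow _)) ?_
  ring

theorem cornerSum_local {ζ : ℂ} {N : ℕ} (hN : 2 ≤ N) (hζ : IsPrimitiveRoot ζ (2 * N + 1)) :
    ∃ u ∈ regularAt ζ, cornerSum q 1 2 1 (2 * N - 1) =
      (1 - q ^ (2 * N + 1)) * (q ^ (N - 1))⁻¹ *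
        (1 + (((2 * N + 1 : ℕ) : RatFunc ℚ) ^ 2 - 1) / 24 * (1 - q ^ (2 * N + 1)) ^ 2) +
          cycl (2 * N + 1) ^ 4 * u := by
  set O := regularAt ζ with hO
  set Y := q ^ (2 * N + 1) with hY
  have hY0 : Y ≠ 0 := pow_ne_zero _ q_ne_zero
  have hζ0 : ζ ≠ 0 := hζ.ne_zero (by omega)
  have hne : ∀ e, e ≠ 0 → e < 2 * N + 1 → 1 - ζ ^ e ≠ 0 := fun e h0 he =>
    sub_ne_zero.2 (Ne.symm (hζ.pow_ne_one_of_pos_of_lt h0 he))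
  have vq := HasValueAt.q ζ
  have v1 := HasValueAt.one ζ
  have vY : HasValueAt ζ Y 1 := (vq.pow _).congr hζ.pow_eq_one
  have v2 : HasValueAt ζ 2 2 := HasValueAt.ofNat ζ 2
  have vYi : HasValueAt ζ Y⁻¹ 1 := (vY.inv one_ne_zero).congr inv_one
  set w := Y + Y⁻¹ with hw
  have vw : HasValueAt ζ w 2 := (vY.add vYi).congr one_add_one_eq_two
  have hden : ∀ i < 2 * N - 2, ∀ {B w y : RatFunc ℚ}, HasValueAt ζ B 1 → HasValueAt ζ w 2 →
      HasValueAt ζ y 1 → cornerDen q B w y i ≠ 0 ∧ (cornerDen q B w y i)⁻¹ ∈ O := by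
    intro i hi B w y hB hw hy
    have h := hasValueAt_cornerDen hB hw hy i
    have h0 : (1 - ζ ^ (2 * i + 2)) * (1 - ζ ^ (i + 1)) ^ 2 * (1 - ζ ^ (i + 3)) * ζ ^ (i + 3) ≠ 0 := by
      refine mul_ne_zero (mul_ne_zero (mul_ne_zero ?_ (pow_ne_zero _ (hne _ (by omega) (by omega))))
        (hne _ (by omega) (by omega))) (pow_ne_zero _ hζ0)
      have e : (1 - ζ ^ (2 * i + 2)) = (1 - ζ ^ (i + 1)) * (1 + ζ ^ (i + 1)) := by ring
      rw [sub_ne_zero]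
      intro h2
      have h3 := (hζ.pow_eq_one_iff_dvd _).1 h2.symm
      have h4 : 2 * N + 1 ∣ i + 1 := by
        refine Nat.Coprime.dvd_of_dvd_mul_left (k := 2 * N + 1) (m := 2) ?_ (by convert h3 using 1; ring)
        rw [Nat.coprime_two_right]; exact odd_two_mul_add_one N
      exact absurd (Nat.le_of_dvd (Nat.succ_pos _) h4) (by omega)
    exact ⟨h.ne_zero h0, (h.inv h0).mem⟩
  have vB : ∀ b : Bool, HasValueAt ζ (if b then Y else 1) 1 := by
    intro b; cases b
    · exact v1
    · exact vY
  have vW : ∀ b : Bool, HasValueAt ζ (if b then w else 2) 2 := by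
    intro b; cases b
    · exact v2
    · exact vw
  obtain ⟨⟨u₁, hu₁, e₁⟩, ⟨u₂, hu₂, e₂⟩, ⟨u₃, hu₃, e₃⟩⟩ := cornerSum_cube O (q := q) (Y := Y)
    (w₀ := 2) (w₁ := w) (M := 2 * N - 2) vq.mem vY.mem v2.mem vw.mem
    (fun i hi b c e => (hden i hi (vB b) (vW c) (vB e)).1)
    (fun i hi b c e => (hden i hi (vB b) (vW c) (vB e)).2)
    (fun c e => by
      have hYm : Y = q ^ (2 * N - 2 + 3) := by rw [hY]; congr 1; omega
      have := cornerSum_eq_zero q_ne_zero q_pow_ne_one (m := 2 * N - 2)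
        ⟨N - 1, by omega⟩ (by omega) (if c then w else 2) (if e then Y else 1)
        (by
          intro i hi
          rw [← hYm]
          exact (hden i hi vY (vW c) (vB e)).1)
      rwa [← hYm] at this)
  rw [show 2 * N - 2 + 1 = 2 * N - 1 by omega] at e₁ e₂ e₃
  have hlin := cornerSum_eq_linear q_ne_zero q_pow_ne_one (w := w) (N := N - 1) (M := 2 * N - 1)
    (by omega) (by
      rw [show 2 * (N - 1) + 3 = 2 * N + 1 by omega, ← hY, hw]; field_simp)
    (fun i hi => (hden i (by omega) v1 vw v1).1)
  rw [show 2 * (N - 1) + 3 = 2 * N + 1 by omega, ← hY] at hlin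
  obtain ⟨c, hc⟩ := cornerSum_eq_div q_ne_zero q_pow_ne_one (N := N) (M := 2 * N - 1) (by omega)
  have c2 := hc 2 fun i hi => by
    rw [← hY]; exact (hden i (by omega) v1 v2 vY).1
  have cw := hc w fun i hi => by
    rw [← hY]; exact (hden i (by omega) v1 vw vY).1
  rw [← hY] at c2 cw
  have vA : ∀ {w}, HasValueAt ζ w 2 → ∀ i, HasValueAt ζ (Y - q ^ (i + 1) * w + q ^ (2 * i + 2))
      ((1 - ζ ^ (i + 1)) ^ 2) := fun hw i =>
    ((vY.sub ((vq.pow _).mul hw)).add (vq.pow _)).congr (by ring)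
  have nA : ∀ i ∈ range N, (1 - ζ ^ (i + 1)) ^ 2 ≠ 0 := fun i hi =>
    pow_ne_zero _ (hne _ (by omega) (by simp at hi; omega))
  have vc : ∀ i ∈ range N, HasValueAt ζ (q ^ (i + 1) / (Y - q ^ (i + 1) * w + q ^ (2 * i + 2)))
    (ζ ^ (i + 1) / (1 - ζ ^ (i + 1)) ^ 2) := fun i hi => (vq.pow _).div (vA vw i) (nA i hi)
  have ht : w - 2 ∈ O := (vw.sub v2).mem
  obtain ⟨u₄, hu₄, e₄⟩ := prod_one_add_mul O (range N) ht (fun i hi => (vc i hi).mem)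
  have hD2 : ∏ i ∈ range N, (Y - q ^ (i + 1) * 2 + q ^ (2 * i + 2)) ≠ 0 :=
    prod_ne_zero_iff.2 fun i hi => (vA v2 i).ne_zero (nA i hi)
  have hDw : ∏ i ∈ range N, (Y - q ^ (i + 1) * w + q ^ (2 * i + 2)) ≠ 0 :=
    prod_ne_zero_iff.2 fun i hi => (vA vw i).ne_zero (nA i hi)
  have e₅ : cornerSum q 1 w Y (2 * N - 1) = cornerSum q 1 2 Y (2 * N - 1) *
      ∏ i ∈ range N, (1 + q ^ (i + 1) / (Y - q ^ (i + 1) * w + q ^ (2 * i + 2)) * (w - 2)) := by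
    have : ∏ i ∈ range N, (1 + q ^ (i + 1) / (Y - q ^ (i + 1) * w + q ^ (2 * i + 2)) * (w - 2)) =
        (∏ i ∈ range N, (Y - q ^ (i + 1) * 2 + q ^ (2 * i + 2))) /
          ∏ i ∈ range N, (Y - q ^ (i + 1) * w + q ^ (2 * i + 2)) := by
      rw [← prod_div_distrib]
      refine prod_congr rfl fun i hi => ?_
      rw [eq_div_iff ((vA vw i).ne_zero (nA i hi)), add_mul, mul_right_comm,
        div_mul_cancel₀ _ ((vA vw i).ne_zero (nA i hi))]
      ring
    rw [this, c2, cw, div_mul_div_cancel₀ hD2]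
  rw [e₄] at e₅
  set s : RatFunc ℚ := (((2 * N + 1 : ℕ) : RatFunc ℚ) ^ 2 - 1) / 24 with hs
  have vs : HasValueAt ζ s ((((2 * N + 1 : ℕ) : ℂ) ^ 2 - 1) / 24) :=
    (((HasValueAt.natCast ζ _).pow 2).sub v1).div (HasValueAt.ofNat ζ 24) (by norm_num)
  obtain ⟨y₁, hy₁, f₁⟩ := ((vY.sub v1).congr (sub_self 1)).exists_eq_mul hζ (by omega)
  obtain ⟨s₁, hs₁, f₂⟩ := (((HasValueAt.sum _ vc).add vs).congr (by
    rw [sum_root_div_sq hζ]; ring)).exists_eq_mul hζ (by omega)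
  have f₃ : (w - 2) * Y = (Y - 1) ^ 2 := by rw [hw]; field_simp; ring
  have hqi : q ^ (N - 1) ≠ 0 := pow_ne_zero _ q_ne_zero
  have vqi : (q ^ (N - 1))⁻¹ ∈ O := ((vq.pow (N - 1)).inv (pow_ne_zero _ hζ0)).mem
  have hE : cornerSum q 1 w 1 (2 * N - 1) = (1 - Y) * (q ^ (N - 1))⁻¹ := by
    rw [← hlin]; field_simp
  have hΦ := (hasValueAt_cycl hζ (Nat.succ_pos _)).mem
  generalize cornerSum q 1 2 1 (2 * N - 1) = V at *
  generalize cornerSum q 1 w 1 (2 * N - 1) = E at *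
  generalize cornerSum q 1 2 Y (2 * N - 1) = V' at *
  generalize cornerSum q 1 w Y (2 * N - 1) = E' at *
  generalize (q ^ (N - 1))⁻¹ = Q at *
  generalize ∑ i ∈ range N, q ^ (i + 1) / (Y - q ^ (i + 1) * w + q ^ (2 * i + 2)) = X at *
  generalize cycl (2 * N + 1) = Φ at *
  have f₄ : w - 2 = (Y - 1) ^ 2 * Y⁻¹ := by rw [← f₃]; field_simp
  have f₅ : Y * Y⁻¹ = 1 := mul_inv_cancel₀ hY0
  have mΦ : Φ ∈ O := hΦ
  have mYi := vYi.mem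
  have mz := (vY.sub v1).mem
  have ms := vs.mem
  generalize w - 2 = T at *
  generalize Y⁻¹ = Yi at *
  set z := Y - 1 with hz
  have hv : V' = z * (-Q + T * u₁ - z * u₂) := by linear_combination e₁ - e₂ + hE
  set v := -Q + T * u₁ - z * u₂ with hvd
  have mv : v ∈ O := O.sub_mem (O.add_mem (O.neg_mem vqi) (O.mul_mem ht hu₁)) (O.mul_mem mz hu₂)
  refine ⟨y₁ ^ 4 * (s * Q * Yi + s * (z * Yi * u₁ - u₂) * Yi - z * v * Yi ^ 2 * u₄ + Yi * u₃) -
    y₁ ^ 3 * v * Yi * s₁, ?_, ?_⟩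
  · exact O.sub_mem (O.mul_mem (O.pow_mem hy₁ 4) (O.add_mem (O.sub_mem (O.add_mem
      (O.mul_mem (O.mul_mem ms vqi) mYi) (O.mul_mem (O.mul_mem ms (O.sub_mem (O.mul_mem
      (O.mul_mem mz mYi) hu₁) hu₂)) mYi)) (O.mul_mem (O.mul_mem (O.mul_mem mz mv)
      (O.pow_mem mYi 2)) hu₄)) (O.mul_mem mYi hu₃))) (O.mul_mem (O.mul_mem (O.mul_mem
      (O.pow_mem hy₁ 3) mv) mYi) hs₁)
  · have g₁ : V = -z * Q - V' * T * (X + T * u₄) + z ^ 2 * T * u₃ := by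
      linear_combination e₃ - e₅ + hE
    have g₂ : X = -s + Φ * s₁ := by linear_combination f₂
    have g₃ : Yi = 1 - z * Yi := by rw [hz]; linear_combination f₅
    have g₄ : (1 : RatFunc ℚ) - Y = -z := by rw [hz]; ring
    rw [g₁, g₂, hv, g₄]
    have g₅ : Φ ^ 4 * (y₁ ^ 4 * (s * Q * Yi + s * (z * Yi * u₁ - u₂) * Yi -
        z * v * Yi ^ 2 * u₄ + Yi * u₃) - y₁ ^ 3 * v * Yi * s₁) =
        z ^ 4 * (s * Q * Yi + s * (z * Yi * u₁ - u₂) * Yi -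
        z * v * Yi ^ 2 * u₄ + Yi * u₃) - z ^ 3 * Φ * v * Yi * s₁ := by
      rw [f₁]; ring
    rw [g₅, f₄]
    rw [f₄] at hvd
    clear_value v z
    rw [hvd]
    linear_combination (-s * Q * z ^ 3) * g₃

end Local

section Summand

/-- The summand of the `q`-congruence. -/
noncomputable def summand (k : ℕ) : RatFunc ℚ :=
  qint (3 * k) * qint (2 * k) * (qint k) ^ 2 /
    (qint (2 * (k : ℤ) - 1) * (qpoch (-q) q k) ^ 4) *
      (qcb k) ^ 3 * q ^ (-(((k : ℤ) ^ 2 + 3 * k) / 2))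

theorem qint_natCast (m : ℕ) : qint m = (1 - q ^ m) / (1 - q) := by
  rw [qint, zpow_natCast]

theorem one_sub_q_pow_ne_zero (m : ℕ) (hm : 0 < m) : 1 - q ^ m ≠ 0 :=
  sub_ne_zero.2 (Ne.symm (q_pow_ne_one m hm))

theorem one_sub_q_ne_zero : 1 - q ≠ 0 := by simpa using one_sub_q_pow_ne_zero 1 one_pos

theorem one_add_q_pow_ne_zero (m : ℕ) : 1 + q ^ m ≠ 0 :=
  ((HasValueAt.one 1).add ((HasValueAt.q 1).pow m)).ne_zero (by norm_num)

theorem qpoch_q (k : ℕ) : qpoch q q k = ∏ i ∈ range k, (1 - q ^ (i + 1)) :=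
  prod_congr rfl fun i _ => by ring

theorem qpoch_neg_q (k : ℕ) : qpoch (-q) q k = ∏ i ∈ range k, (1 + q ^ (i + 1)) :=
  prod_congr rfl fun i _ => by ring

theorem qpoch_q_ne_zero (k : ℕ) : qpoch q q k ≠ 0 := by
  rw [qpoch_q]
  exact prod_ne_zero_iff.2 fun i _ => one_sub_q_pow_ne_zero _ i.succ_pos

theorem qpoch_neg_q_ne_zero (k : ℕ) : qpoch (-q) q k ≠ 0 := by
  rw [qpoch_neg_q]
  exact prod_ne_zero_iff.2 fun i _ => one_add_q_pow_ne_zero _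

theorem summand_zero : summand 0 = 0 := by simp [summand, qint]

theorem summand_succ (k : ℕ) : summand (k + 1) =
    (1 - q ^ (3 * k + 3)) * (1 - q ^ (2 * k + 2)) * (1 - q ^ (k + 1)) ^ 2 /
      ((1 - q) ^ 3 * (1 - q ^ (2 * k + 1)) * (qpoch (-q) q (k + 1)) ^ 4) *
        (qcb (k + 1)) ^ 3 * (q ^ ((k + 1) * (k + 4) / 2))⁻¹ := by
  have h1 : (3 * ((k + 1 : ℕ) : ℤ)) = ((3 * k + 3 : ℕ) : ℤ) := by push_cast; ring
  have h2 : (2 * ((k + 1 : ℕ) : ℤ)) = ((2 * k + 2 : ℕ) : ℤ) := by push_cast; ring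
  have h3 : ((2 * k + 2 : ℕ) : ℤ) - 1 = ((2 * k + 1 : ℕ) : ℤ) := by push_cast; ring
  have h4 : (((k + 1 : ℕ) : ℤ) ^ 2 + ((3 * k + 3 : ℕ) : ℤ)) / 2 = (((k + 1) * (k + 4) / 2 : ℕ) : ℤ) := by
    push_cast; congr 1; ring
  have hq1 := one_sub_q_ne_zero
  have hq2 := one_sub_q_pow_ne_zero (2 * k + 1) (by omega)
  have hq3 := qpoch_neg_q_ne_zero (k + 1)
  unfold summand
  rw [h1, h2, h3, h4, qint_natCast, qint_natCast, qint_natCast, qint_natCast, zpow_neg,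
    zpow_natCast]
  congr 2
  field_simp

theorem qcb_succ (k : ℕ) : qcb (k + 1) =
    qcb k * ((1 - q ^ (2 * k + 1)) * (1 - q ^ (2 * k + 2)) / (1 - q ^ (k + 1)) ^ 2) := by
  unfold qcb
  simp only [qpoch_q]
  rw [show 2 * (k + 1) = 2 * k + 1 + 1 by ring, prod_range_succ, prod_range_succ, prod_range_succ]
  rw [div_mul_div_comm]
  congr 1 <;> ring

theorem summand_succ_eq_corner (k : ℕ) : summand (k + 1) = (q ^ 2)⁻¹ / (1 - q) *
    ((1 - q ^ (3 * k + 3)) *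
      ∏ i ∈ range k, (cornerNum q 1 2 1 i * (cornerDen q 1 2 1 i)⁻¹)) := by
  have key : (1 - q ^ (2 * k + 2)) * (1 - q ^ (k + 1)) ^ 2 /
      ((1 - q) ^ 2 * (1 - q ^ (2 * k + 1)) * (qpoch (-q) q (k + 1)) ^ 4) *
        (qcb (k + 1)) ^ 3 * (q ^ ((k + 1) * (k + 4) / 2))⁻¹ = (q ^ 2)⁻¹ *
      ∏ i ∈ range k, (cornerNum q 1 2 1 i * (cornerDen q 1 2 1 i)⁻¹) := by
    have hq0 := q_ne_zero
    have hq1 := one_sub_q_ne_zero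
    induction k with
    | zero =>
      have h1 : 1 + q ≠ 0 := by simpa using one_add_q_pow_ne_zero 1
      have h2 : 1 - q ^ 2 = (1 - q) * (1 + q) := by ring
      rw [qcb_succ]
      simp only [qcb, qpoch_q, qpoch_neg_q, prod_range_zero, prod_range_one, mul_zero, zero_add,
        pow_one, h2]
      norm_num
      field_simp
    | succ k ih =>
      rw [prod_range_succ, ← mul_assoc, ← ih, qcb_succ (k + 1)]
      have h1 := one_sub_q_pow_ne_zero (2 * k + 1) (by omega)
      have h2 := one_sub_q_pow_ne_zero (2 * k + 2) (by omega)
      have h3 := one_sub_q_pow_ne_zero (2 * k + 3) (by omega)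
      have h4 := one_sub_q_pow_ne_zero (k + 2) (by omega)
      have h5 := one_sub_q_pow_ne_zero (k + 1) (by omega)
      have h6 := one_sub_q_pow_ne_zero (k + 3) (by omega)
      have h7 := one_add_q_pow_ne_zero (k + 2)
      have h8 := qpoch_neg_q_ne_zero (k + 1)
      have e1 : (k + 1 + 1) * (k + 1 + 4) / 2 = (k + 1) * (k + 4) / 2 + (k + 3) := by
        rw [show (k + 1 + 1) * (k + 1 + 4) = (k + 1) * (k + 4) + (k + 3) * 2 by ring,
          Nat.add_mul_div_right _ _ two_pos]
      have e2 : qpoch (-q) q (k + 1 + 1) = qpoch (-q) q (k + 1) * (1 + q ^ (k + 2)) := by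
        rw [qpoch_neg_q, qpoch_neg_q, prod_range_succ]
      have e3 : cornerNum q 1 2 1 k = (1 - q ^ (k + 3)) * (1 - q ^ (2 * k + 3)) ^ 2 *
          (1 - q ^ (2 * k + 1)) := by unfold cornerNum; ring
      have e4 : cornerDen q 1 2 1 k = (1 - q ^ (2 * k + 2)) * (1 - q ^ (k + 1)) ^ 2 *
          (1 - q ^ (k + 3)) * q ^ (k + 3) := by unfold cornerDen; ring
      have e5 : 1 - q ^ (2 * (k + 1) + 2) = (1 - q ^ (k + 2)) * (1 + q ^ (k + 2)) := by ring
      rw [e1, e2, e3, e4, e5, show 2 * (k + 1) + 1 = 2 * k + 3 by ring,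
        show k + 1 + 1 = k + 2 by ring, pow_add q _ (k + 3)]
      generalize qpoch (-q) q (k + 1) = A at *
      generalize qcb (k + 1) = B at *
      generalize 1 - q ^ (2 * k + 1) = c1 at *
      generalize 1 - q ^ (2 * k + 2) = c2 at *
      generalize 1 - q ^ (2 * k + 3) = c3 at *
      generalize 1 - q ^ (k + 1) = c4 at *
      generalize 1 - q ^ (k + 2) = c5 at *
      generalize 1 - q ^ (k + 3) = c6 at *
      generalize 1 + q ^ (k + 2) = c7 at *
      have n1 : q ^ (k + 3) ≠ 0 := pow_ne_zero _ hq0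
      have n2 : q ^ ((k + 1) * (k + 4) / 2) ≠ 0 := pow_ne_zero _ hq0
      generalize q ^ (k + 3) = d1 at *
      generalize q ^ ((k + 1) * (k + 4) / 2) = d2 at *
      field_simp
  rw [summand_succ]
  have hq1 := one_sub_q_ne_zero
  calc _ = (1 - q ^ (3 * k + 3)) / (1 - q) * ((1 - q ^ (2 * k + 2)) * (1 - q ^ (k + 1)) ^ 2 /
      ((1 - q) ^ 2 * (1 - q ^ (2 * k + 1)) * (qpoch (-q) q (k + 1)) ^ 4) *
        (qcb (k + 1)) ^ 3 * (q ^ ((k + 1) * (k + 4) / 2))⁻¹) := by field_simp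
    _ = _ := by rw [key]; field_simp

theorem sum_summand (M : ℕ) : ∑ k ∈ range (M + 1), summand k =
    (q ^ 2)⁻¹ / (1 - q) * cornerSum q 1 2 1 M := by
  rw [sum_range_succ', summand_zero, add_zero, cornerSum, mul_sum]
  exact sum_congr rfl fun k _ => summand_succ_eq_corner k

end Summand

section LocalCongruence

/-- The value of the sum modulo `[n] Φ_n(q)^3`. -/
noncomputable def congrValue (n : ℕ) : RatFunc ℚ :=
  qint n * q ^ (-(((n : ℤ) + 1) / 2)) + (1 + q) * (qint n) ^ 3 +
    ((n : RatFunc ℚ) ^ 2 - 1) * (1 - q) ^ 2 / 24 * (qint n) ^ 3 * q ^ (-(((n : ℤ) + 1) / 2))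

theorem congrValue_eq (N : ℕ) : congrValue (2 * N + 1) =
    (1 - q ^ (2 * N + 1)) / (1 - q) * (q ^ (N + 1))⁻¹ *
      (1 + (((2 * N + 1 : ℕ) : RatFunc ℚ) ^ 2 - 1) / 24 * (1 - q ^ (2 * N + 1)) ^ 2) +
        (1 - q ^ (2 * N + 1)) ^ 3 * ((1 + q) / (1 - q) ^ 3) := by
  have h : (((2 * N + 1 : ℕ) : ℤ) + 1) / 2 = ((N + 1 : ℕ) : ℤ) := by push_cast; omega
  have hq1 := one_sub_q_ne_zero
  rw [congrValue, h, zpow_neg, zpow_natCast, qint_natCast]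
  field_simp
  ring

theorem prod_one_add_root {ζ : ℂ} {N : ℕ} (hζ : IsPrimitiveRoot ζ (2 * N + 1)) :
    ∏ i ∈ range (2 * N), (1 + ζ ^ (i + 1)) = 1 := by
  have h1 := hζ.prod_one_sub_pow_eq_order
  have hcop : Nat.Coprime 2 (2 * N + 1) := by
    rw [Nat.coprime_two_left]; exact odd_two_mul_add_one N
  have h2 := (hζ.pow_of_coprime 2 hcop).prod_one_sub_pow_eq_order
  have h3 : ∏ i ∈ range (2 * N), (1 - (ζ ^ 2) ^ (i + 1)) =
      (∏ i ∈ range (2 * N), (1 - ζ ^ (i + 1))) * ∏ i ∈ range (2 * N), (1 + ζ ^ (i + 1)) := by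
    rw [← prod_mul_distrib]
    exact prod_congr rfl fun i _ => by ring
  rw [h3, h1] at h2
  have h0 : ((2 * N : ℕ) : ℂ) + 1 ≠ 0 := Nat.cast_add_one_ne_zero (2 * N)
  exact mul_left_cancel₀ h0 (by rw [h2, mul_one])

theorem last_summand_local {ζ : ℂ} {N : ℕ} (hN : 2 ≤ N) (hζ : IsPrimitiveRoot ζ (2 * N + 1)) :
    ∃ x, HasValueAt ζ x ((1 + ζ) / (1 - ζ) ^ 3) ∧
      summand (2 * N) = (1 - q ^ (2 * N + 1)) ^ 3 * x := by
  have hζ0 : ζ ≠ 0 := hζ.ne_zero (by omega)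
  have hne : ∀ e, e ≠ 0 → e < 2 * N + 1 → 1 - ζ ^ e ≠ 0 := fun e h0 he =>
    sub_ne_zero.2 (Ne.symm (hζ.pow_ne_one_of_pos_of_lt h0 he))
  have vq := HasValueAt.q ζ
  have v1 := HasValueAt.one ζ
  have hcb : qcb (2 * N) = (1 - q ^ (2 * N + 1)) *
      ((∏ i ∈ range (2 * N - 1), (1 - q ^ (2 * N + (i + 1) + 1))) /
        ∏ i ∈ range (2 * N), (1 - q ^ (i + 1))) := by
    have h0 := qpoch_q_ne_zero (2 * N)
    rw [qcb, qpoch_q, qpoch_q, two_mul (2 * N), prod_range_add]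
    rw [qpoch_q] at h0
    have : ∏ i ∈ range (2 * N), (1 - q ^ (2 * N + i + 1)) =
        (∏ i ∈ range (2 * N - 1), (1 - q ^ (2 * N + (i + 1) + 1))) * (1 - q ^ (2 * N + 1)) := by
      conv_lhs => rw [show 2 * N = (2 * N - 1) + 1 by omega, prod_range_succ']
      rw [show 2 * N - 1 + 1 = 2 * N by omega]
    rw [this]
    field_simp
  have vcb : HasValueAt ζ ((∏ i ∈ range (2 * N - 1), (1 - q ^ (2 * N + (i + 1) + 1))) /
        ∏ i ∈ range (2 * N), (1 - q ^ (i + 1))) (1 / (1 - ζ ^ (2 * N))) := by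
    have hd : ∏ i ∈ range (2 * N), (1 - ζ ^ (i + 1)) ≠ 0 :=
      prod_ne_zero_iff.2 fun i hi => hne _ (by omega) (by simp at hi; omega)
    refine ((HasValueAt.prod _ fun i _ => v1.sub (vq.pow _)).div
      (HasValueAt.prod _ fun i _ => v1.sub (vq.pow _)) hd).congr ?_
    have e : ∏ i ∈ range (2 * N - 1), (1 - ζ ^ (2 * N + (i + 1) + 1)) =
        ∏ i ∈ range (2 * N - 1), (1 - ζ ^ (i + 1)) := prod_congr rfl fun i _ => by
      rw [show 2 * N + (i + 1) + 1 = 2 * N + 1 + (i + 1) by ring, pow_add, hζ.pow_eq_one, one_mul]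
    have e' : ∏ i ∈ range (2 * N), (1 - ζ ^ (i + 1)) =
        (∏ i ∈ range (2 * N - 1), (1 - ζ ^ (i + 1))) * (1 - ζ ^ (2 * N)) := by
      conv_lhs => rw [show 2 * N = (2 * N - 1) + 1 by omega, prod_range_succ]
      rw [show 2 * N - 1 + 1 = 2 * N by omega]
    rw [e, e']
    rw [e'] at hd
    have := left_ne_zero_of_mul hd
    have := right_ne_zero_of_mul hd
    field_simp
  have vA : HasValueAt ζ (qpoch (-q) q (2 * N)) 1 := by
    rw [qpoch_neg_q]
    exact (HasValueAt.prod _ fun i _ => v1.add (vq.pow _)).congr (prod_one_add_root hζ)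
  have hinv : ζ ^ (2 * N) = ζ⁻¹ := eq_inv_of_mul_eq_one_left (by rw [← pow_succ, hζ.pow_eq_one])
  have hexp : 2 * N * (2 * N - 1 + 4) / 2 = (2 * N + 1) * N + 2 * N := by
    rw [show 2 * N - 1 + 4 = 2 * N + 3 by omega, mul_assoc, Nat.mul_div_cancel_left _ two_pos]
    ring
  have n1 : 1 - ζ ≠ 0 := by simpa using hne 1 one_ne_zero (by omega)
  have n3 : 1 - ζ ^ 3 ≠ 0 := hne 3 (by omega) (by omega)
  have w1 : ζ ^ (4 * N - 1) = ζ⁻¹ ^ 3 := by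
    rw [inv_pow]
    refine eq_inv_of_mul_eq_one_left ?_
    rw [← pow_add, show 4 * N - 1 + 3 = (2 * N + 1) * 2 by omega, pow_mul, hζ.pow_eq_one, one_pow]
  have n3' : 1 - ζ⁻¹ ^ 3 ≠ 0 := by
    intro h
    apply n3
    have h5 : ζ⁻¹ ^ 3 = 1 := (sub_eq_zero.1 h).symm
    rw [inv_pow, inv_eq_one] at h5
    rw [h5, sub_self]
  have n1' : 1 - ζ⁻¹ ≠ 0 := by rw [← hinv]; exact hne _ (by omega) (by omega)
  have hr : ∀ a b c d : RatFunc ℚ, a * (b * c) ^ 3 * d = b ^ 3 * (a * c ^ 3 * d) := by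
    intros; ring
  have hs := summand_succ (2 * N - 1)
  rw [show 2 * N - 1 + 1 = 2 * N by omega, hcb, hexp, hr] at hs
  refine ⟨_, ?_, hs⟩
  · refine (((((((v1.sub (vq.pow _)).mul (v1.sub (vq.pow _))).mul ((v1.sub (vq.pow _)).pow 2)).div
      ((((v1.sub vq).pow 3).mul (v1.sub (vq.pow _))).mul (vA.pow 4)) ?_).mul
        (vcb.pow 3)).mul ((vq.pow _).inv ?_))).congr ?_
    · rw [show 2 * (2 * N - 1) + 1 = 4 * N - 1 by omega, w1]
      exact mul_ne_zero (mul_ne_zero (pow_ne_zero _ n1) n3') (pow_ne_zero _ one_ne_zero)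
    · exact pow_ne_zero _ hζ0
    · rw [show 2 * (2 * N - 1) + 1 = 4 * N - 1 by omega, w1,
        show 3 * (2 * N - 1) + 3 = 2 * N * 3 by omega, show 2 * (2 * N - 1) + 2 = 2 * N * 2 by omega,
        pow_mul ζ (2 * N) 3, pow_mul ζ (2 * N) 2, pow_add, pow_mul ζ (2 * N + 1) N, hζ.pow_eq_one, one_pow, hinv]
      have : (1 - ζ⁻¹ ^ 2) = (1 - ζ⁻¹) * (1 + ζ⁻¹) := by ring
      rw [this]
      generalize hz : ζ⁻¹ = z at *
      have : ζ = z⁻¹ := by rw [← hz, inv_inv]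
      have hzz : ζ * z = 1 := by rw [← hz, mul_inv_cancel₀ hζ0]
      have hz0 : z ≠ 0 := by rw [← hz]; exact inv_ne_zero hζ0
      field_simp
      linear_combination -hzz

theorem sum_summand_local {ζ : ℂ} {n : ℕ} (hn : 1 < n) (hodd : Odd n) (hζ : IsPrimitiveRoot ζ n) :
    ∃ u ∈ regularAt ζ, ∑ k ∈ range n, summand k - congrValue n = cycl n ^ 4 * u := by
  obtain ⟨N, rfl⟩ := hodd
  have hζ0 : ζ ≠ 0 := hζ.ne_zero (by omega)
  have vq := HasValueAt.q ζ
  have v1 := HasValueAt.one ζ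
  have n1 : 1 - ζ ≠ 0 := by
    simpa using sub_ne_zero.2 (Ne.symm (hζ.pow_ne_one_of_pos_of_lt one_ne_zero hn))
  have v3 := (v1.sub vq).pow 3
  have vY : HasValueAt ζ (1 - q ^ (2 * N + 1)) 0 :=
    (v1.sub (vq.pow _)).congr (by rw [hζ.pow_eq_one, sub_self])
  obtain ⟨y, hy, e₁⟩ := vY.exists_eq_mul hζ (by omega)
  have vc : HasValueAt ζ ((1 + q) / (1 - q) ^ 3) ((1 + ζ) / (1 - ζ) ^ 3) :=
    (v1.add vq).div v3 (pow_ne_zero _ n1)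
  have hq0 := q_ne_zero
  have hq1 := one_sub_q_ne_zero
  rcases (by omega : N = 1 ∨ 2 ≤ N) with rfl | hN
  · have hcub : 1 + ζ + ζ ^ 2 = 0 := by
      have := hζ.pow_eq_one
      refine mul_left_cancel₀ n1 ?_
      norm_num at this
      linear_combination -this
    have n2 : 1 - ζ ^ 2 ≠ 0 :=
      sub_ne_zero.2 (Ne.symm (hζ.pow_ne_one_of_pos_of_lt two_ne_zero (by omega)))
    have v : HasValueAt ζ ((1 + q ^ 3) / (q ^ 5 * ((1 - q) ^ 2 * (1 - q ^ 2))) -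
        (1 + q) / (1 - q) ^ 3 - 1 / (3 * (q ^ 2 * (1 - q)))) 0 := by
      refine (((((v1.add (vq.pow 3)).div ((vq.pow 5).mul (((v1.sub vq).pow 2).mul
        (v1.sub (vq.pow 2)))) ?_).sub vc).sub (v1.div ((HasValueAt.ofNat ζ 3).mul
          ((vq.pow 2).mul (v1.sub vq))) ?_))).congr ?_
      · exact mul_ne_zero (pow_ne_zero _ hζ0) (mul_ne_zero (pow_ne_zero _ n1) n2)
      · exact mul_ne_zero (by norm_num) (mul_ne_zero (pow_ne_zero _ hζ0) n1)
      · have n4 : 1 + ζ ≠ 0 := fun h => n2 (by linear_combination (1 - ζ) * h)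
        rw [show (1 - ζ ^ 2) = (1 - ζ) * (1 + ζ) by ring]
        field_simp
        linear_combination (3 - 3 * ζ + 5 * ζ ^ 3 - 4 * ζ ^ 4 - 3 * ζ ^ 5) * hcub
    obtain ⟨u, hu, e₂⟩ := v.exists_eq_mul hζ (by omega)
    refine ⟨y ^ 3 * u, (regularAt ζ).mul_mem ((regularAt ζ).pow_mem hy 3) hu, ?_⟩
    have e₃ : cycl (2 * 1 + 1) ^ 4 * (y ^ 3 * u) = (cycl (2 * 1 + 1) * y) ^ 3 *
      (cycl (2 * 1 + 1) * u) := by ring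
    rw [e₃, ← e₁, ← e₂, sum_summand, congrValue_eq]
    have h2 : (1 + q) ≠ 0 := by simpa using one_add_q_pow_ne_zero 1
    have h3 := one_sub_q_pow_ne_zero 3 (by omega)
    have e₄ : 1 - q ^ 2 = (1 - q) * (1 + q) := by ring
    have e₅ : cornerSum q 1 2 1 2 = (1 - q ^ 3) * (1 + (1 + q ^ 3) * (1 - q ^ 3) ^ 2 /
        ((1 - q ^ 2) * (1 - q) * q ^ 3)) := by
      have h4 : 1 - q ^ 2 ≠ 0 := one_sub_q_pow_ne_zero 2 (by omega)
      have e₆ : cornerNum q 1 2 1 0 * (cornerDen q 1 2 1 0)⁻¹ =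
          (1 - q ^ 3) ^ 2 / ((1 - q ^ 2) * (1 - q) * q ^ 3) := by
        have e₇ : cornerNum q 1 2 1 0 = (1 - q ^ 3) * (1 - q ^ 3) ^ 2 * (1 - q) := by
          unfold cornerNum; ring
        have e₈ : cornerDen q 1 2 1 0 = (1 - q ^ 2) * (1 - q) ^ 2 * (1 - q ^ 3) * q ^ 3 := by
          unfold cornerDen; ring
        rw [e₇, e₈]
        field_simp
      rw [cornerSum, sum_range_succ, sum_range_one, prod_range_zero, prod_range_one, e₆]
      norm_num
      ring
    rw [show 2 * 1 = 2 from rfl, e₅, e₄]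
    norm_num
    field_simp
    ring
  · obtain ⟨x, hx, e₂⟩ := last_summand_local hN hζ
    obtain ⟨u₁, hu₁, e₃⟩ := cornerSum_local hN hζ
    obtain ⟨u₂, hu₂, e₄⟩ := ((hx.sub vc).congr (sub_self _)).exists_eq_mul hζ (by omega)
    have hv : (q ^ 2)⁻¹ / (1 - q) ∈ regularAt ζ :=
      (((vq.pow 2).inv (pow_ne_zero _ hζ0)).div (v1.sub vq) n1).mem
    refine ⟨(q ^ 2)⁻¹ / (1 - q) * u₁ + y ^ 3 * u₂, (regularAt ζ).add_mem
      ((regularAt ζ).mul_mem hv hu₁) ((regularAt ζ).mul_mem ((regularAt ζ).pow_mem hy 3) hu₂), ?_⟩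
    have h5 : cycl (2 * N + 1) ^ 4 * ((q ^ 2)⁻¹ / (1 - q) * u₁ + y ^ 3 * u₂) =
        (q ^ 2)⁻¹ / (1 - q) * (cycl (2 * N + 1) ^ 4 * u₁) + (cycl (2 * N + 1) * y) ^ 3 *
          (cycl (2 * N + 1) * u₂) := by ring
    have h6 : q ^ (N + 1) = q ^ 2 * q ^ (N - 1) := by rw [← pow_add]; congr 1; omega
    have h7 := sum_summand (2 * N - 1)
    rw [show 2 * N - 1 + 1 = 2 * N by omega, e₃] at h7
    rw [h5, ← e₁, ← e₄, sum_range_succ, h7, e₂, congrValue_eq, h6, mul_inv]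
    ring

end LocalCongruence

section LowerRoot
variable {ζ : ℂ} {d : ℕ}

theorem IsPrimitiveRoot.pow_mul_add (hζ : IsPrimitiveRoot ζ d) (l r : ℕ) :
    ζ ^ (d * l + r) = ζ ^ r := by
  rw [pow_add, pow_mul, hζ.pow_eq_one, one_pow, one_mul]

theorem one_sub_q_pow_mul (hζ : IsPrimitiveRoot ζ d) (t : ℕ) :
    ∃ u, HasValueAt ζ u t ∧ 1 - q ^ (d * t) = (1 - q ^ d) * u := by
  refine ⟨∑ j ∈ range t, (q ^ d) ^ j, ?_, ?_⟩
  · refine (HasValueAt.sum _ fun i _ => ((HasValueAt.q ζ).pow d).pow i).congr ?_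
    simp [hζ.pow_eq_one]
  · rw [pow_mul, mul_neg_geom_sum]

theorem qpoch_factor (hζ : IsPrimitiveRoot ζ d) (hd : 0 < d) (l s : ℕ) :
    ∃ u, HasValueAt ζ u ((∏ i ∈ range (d - 1), (1 - ζ ^ (i + 1))) ^ l * l.factorial *
      ∏ i ∈ range s, (1 - ζ ^ (i + 1))) ∧ qpoch q q (d * l + s) = (1 - q ^ d) ^ l * u := by
  have hblock : ∀ l s, HasValueAt ζ (∏ i ∈ range s, (1 - q ^ (d * l + i + 1)))
      (∏ i ∈ range s, (1 - ζ ^ (i + 1))) := fun l s =>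
    HasValueAt.prod _ fun i _ => by
      have := (HasValueAt.one ζ).sub ((HasValueAt.q ζ).pow (d * l + i + 1))
      rwa [add_assoc (d * l), hζ.pow_mul_add] at this
  have h0 : ∃ u, HasValueAt ζ u ((∏ i ∈ range (d - 1), (1 - ζ ^ (i + 1))) ^ l * l.factorial) ∧
      qpoch q q (d * l) = (1 - q ^ d) ^ l * u := by
    induction l with
    | zero => exact ⟨1, by simpa using HasValueAt.one ζ, by simp [qpoch]⟩
    | succ l ih =>
      obtain ⟨u, hu, h⟩ := ih
      obtain ⟨v, hv, h'⟩ := one_sub_q_pow_mul hζ (l + 1)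
      refine ⟨_, ((hu.mul (hblock l (d - 1))).mul hv).congr ?_, ?_⟩
      · rw [Nat.factorial_succ]; push_cast; ring
      · rw [qpoch_q] at h ⊢
        rw [mul_add, mul_one, prod_range_add, h]
        conv_lhs => rw [show d = d - 1 + 1 by omega, prod_range_succ]
        rw [show d - 1 + 1 = d by omega, show d * l + (d - 1) + 1 = d * (l + 1) by
          rw [mul_add]; omega, h']
        ring
  obtain ⟨u, hu, h⟩ := h0
  refine ⟨_, hu.mul (hblock l s), ?_⟩
  rw [qpoch_q] at h ⊢
  rw [prod_range_add, h, mul_assoc]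

theorem prod_one_sub_root_ne_zero (hζ : IsPrimitiveRoot ζ d) {s : ℕ} (hs : s < d) :
    ∏ i ∈ range s, (1 - ζ ^ (i + 1)) ≠ 0 :=
  prod_ne_zero_iff.2 fun i hi => sub_ne_zero.2 (Ne.symm
    (hζ.pow_ne_one_of_pos_of_lt i.succ_ne_zero (by simp at hi; omega)))

theorem one_add_root_ne_zero (hζ : IsPrimitiveRoot ζ d) (hd : Odd d) (j : ℕ) : 1 + ζ ^ j ≠ 0 := by
  intro h
  have h1 : ζ ^ j = -1 := by linear_combination h
  have h2 : (ζ ^ j) ^ d = 1 := by rw [← pow_mul, mul_comm, pow_mul, hζ.pow_eq_one, one_pow]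
  rw [h1, hd.neg_one_pow] at h2
  norm_num at h2

theorem hasValueAt_qpoch_neg (hζ : IsPrimitiveRoot ζ d) (hd : Odd d) (l r : ℕ) :
    HasValueAt ζ (qpoch (-q) q (d * l + r)) (2 ^ l * ∏ i ∈ range r, (1 + ζ ^ (i + 1))) := by
  have hblock : ∀ l s, HasValueAt ζ (∏ i ∈ range s, (1 + q ^ (d * l + i + 1)))
      (∏ i ∈ range s, (1 + ζ ^ (i + 1))) := fun l s =>
    HasValueAt.prod _ fun i _ => by
      have := (HasValueAt.one ζ).add ((HasValueAt.q ζ).pow (d * l + i + 1))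
      rwa [add_assoc (d * l), hζ.pow_mul_add] at this
  have hfull : ∏ i ∈ range d, (1 + ζ ^ (i + 1)) = 2 := by
    obtain ⟨N, rfl⟩ := hd
    rw [prod_range_succ, prod_one_add_root hζ, hζ.pow_eq_one]; norm_num
  have h0 : HasValueAt ζ (∏ i ∈ range (d * l), (1 + q ^ (i + 1))) (2 ^ l) := by
    induction l with
    | zero => simpa using HasValueAt.one ζ
    | succ l ih =>
      rw [mul_add, mul_one, prod_range_add, pow_succ]
      exact ih.mul ((hblock l d).congr hfull)
  rw [qpoch_neg_q, prod_range_add]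
  exact h0.mul (hblock l r)

theorem hasValueAt_qcb (hζ : IsPrimitiveRoot ζ d) (hd : 0 < d) (l : ℕ) {r : ℕ} (hr : 2 * r < d) :
    HasValueAt ζ (qcb (d * l + r)) ((2 * l).factorial / (l.factorial : ℂ) ^ 2 *
      ((∏ i ∈ range (2 * r), (1 - ζ ^ (i + 1))) / (∏ i ∈ range r, (1 - ζ ^ (i + 1))) ^ 2)) := by
  obtain ⟨u, hu, h⟩ := qpoch_factor hζ hd (2 * l) (2 * r)
  obtain ⟨v, hv, h'⟩ := qpoch_factor hζ hd l r
  have n1 : ∏ i ∈ range (d - 1), (1 - ζ ^ (i + 1)) ≠ 0 := prod_one_sub_root_ne_zero hζ (by omega)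
  have n2 : ∏ i ∈ range r, (1 - ζ ^ (i + 1)) ≠ 0 := prod_one_sub_root_ne_zero hζ (by omega)
  have n3 : (l.factorial : ℂ) ≠ 0 := Nat.cast_ne_zero.2 l.factorial_ne_zero
  have n4 := mul_ne_zero (mul_ne_zero (pow_ne_zero l n1) n3) n2
  have n5 := one_sub_q_pow_ne_zero d hd
  have n6 := hv.ne_zero n4
  have e : qcb (d * l + r) = u / v ^ 2 := by
    rw [qcb, show 2 * (d * l + r) = d * (2 * l) + 2 * r by ring, h, h', pow_mul' _ 2 l]
    field_simp
  rw [e]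
  refine (hu.div (hv.pow 2) (pow_ne_zero _ n4)).congr ?_
  field_simp
  ring

theorem qcb_eq_mul (hζ : IsPrimitiveRoot ζ d) (l : ℕ) {r : ℕ} (hrd : r < d)
    (hr : d ≤ 2 * r) : ∃ u ∈ regularAt ζ, qcb (d * l + r) = (1 - q ^ d) * u := by
  have hd : 0 < d := by omega
  obtain ⟨u, hu, h⟩ := qpoch_factor hζ hd (2 * l + 1) (2 * r - d)
  obtain ⟨v, hv, h'⟩ := qpoch_factor hζ hd l r
  have n1 : ∏ i ∈ range (d - 1), (1 - ζ ^ (i + 1)) ≠ 0 := prod_one_sub_root_ne_zero hζ (by omega)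
  have n2 : ∏ i ∈ range r, (1 - ζ ^ (i + 1)) ≠ 0 := prod_one_sub_root_ne_zero hζ (by omega)
  have n3 : (l.factorial : ℂ) ≠ 0 := Nat.cast_ne_zero.2 l.factorial_ne_zero
  have n4 := mul_ne_zero (mul_ne_zero (pow_ne_zero l n1) n3) n2
  have n5 := one_sub_q_pow_ne_zero d hd
  have n6 := hv.ne_zero n4
  refine ⟨u / v ^ 2, (hu.div (hv.pow 2) (pow_ne_zero _ n4)).mem, ?_⟩
  have e : 2 * (d * l + r) = d * (2 * l + 1) + (2 * r - d) := by
    zify [hr]; ring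
  rw [qcb, e, h, h', pow_succ, pow_mul' _ 2 l]
  field_simp

theorem summand_of_pos {k : ℕ} (hk : 0 < k) : summand k =
    (1 - q ^ (3 * k)) * (1 - q ^ (2 * k)) * (1 - q ^ k) ^ 2 /
      ((1 - q) ^ 3 * (1 - q ^ (2 * k - 1)) * (qpoch (-q) q k) ^ 4) *
        (qcb k) ^ 3 * (q ^ (k * (k + 3) / 2))⁻¹ := by
  obtain ⟨k, rfl⟩ : ∃ j, k = j + 1 := ⟨k - 1, by omega⟩
  rw [summand_succ, show 2 * (k + 1) - 1 = 2 * k + 1 by omega]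
  ring_nf

theorem triangle_shift (hd : Odd d) (l r : ℕ) : ∃ t, (d * l + r) * (d * l + r + 3) / 2 =
    d * t + r * (r + 3) / 2 := by
  obtain ⟨t, ht⟩ : Even (l * (d * l + 2 * r + 3)) := by
    rcases Nat.even_or_odd l with h | h
    · exact h.mul_right _
    · refine Even.mul_left ?_ _
      rw [show d * l + 2 * r + 3 = (d * l + 1) + 2 * (r + 1) by ring]
      exact ((hd.mul h).add_odd odd_one).add (even_two_mul _)
  refine ⟨t, ?_⟩
  have : (d * l + r) * (d * l + r + 3) = r * (r + 3) + 2 * (d * t) := by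
    linear_combination d * ht
  rw [this, Nat.add_mul_div_left _ _ two_pos, add_comm]

theorem hasValueAt_summand (hζ : IsPrimitiveRoot ζ d) (hd : Odd d) (hd1 : 1 < d) {r : ℕ}
    (hr : r < d) : ∃ c, ∀ l, HasValueAt ζ (summand (d * l + r))
      (((2 * l).factorial / (l.factorial : ℂ) ^ 2) ^ 3 / 16 ^ l * c) := by
  have hζ0 : ζ ≠ 0 := hζ.ne_zero (by omega)
  have vq := HasValueAt.q ζ
  have v1 := HasValueAt.one ζ
  have n1 : 1 - ζ ≠ 0 := by
    simpa using sub_ne_zero.2 (Ne.symm (hζ.pow_ne_one_of_pos_of_lt one_ne_zero hd1))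
  have nE : ∀ r, ∏ i ∈ range r, (1 + ζ ^ (i + 1)) ≠ 0 := fun r =>
    prod_ne_zero_iff.2 fun i _ => one_add_root_ne_zero hζ hd _
  have vE := hasValueAt_qpoch_neg hζ hd
  have nE' : ∀ l r, (2 : ℂ) ^ l * ∏ i ∈ range r, (1 + ζ ^ (i + 1)) ≠ 0 := fun l r =>
    mul_ne_zero (pow_ne_zero _ two_ne_zero) (nE r)
  rcases lt_or_ge (2 * r) d with h2 | h2
  · have npole : ∀ l, 0 < d * l + r → 1 - ζ ^ (2 * (d * l + r) - 1) ≠ 0 := by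
      intro l hl h
      have h3 := (hζ.pow_eq_one_iff_dvd _).1 (sub_eq_zero.1 h).symm
      have h4 : ¬ d ∣ 1 := fun h => by
        have := Nat.le_of_dvd one_pos h
        omega
      rcases Nat.eq_zero_or_pos r with rfl | hr0
      · have h5 : 2 * (d * l + 0) = 2 * (d * l + 0) - 1 + 1 := by omega
        apply h4
        rw [← Nat.dvd_add_right h3, ← h5]
        exact Dvd.intro (2 * l) (by ring)
      · have h5 : 2 * (d * l + r) - 1 = d * (2 * l) + (2 * r - 1) := by
          rw [mul_add, mul_left_comm]; omega
        rw [h5, Nat.dvd_add_right (dvd_mul_right _ _)] at h3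
        have := Nat.le_of_dvd (by omega) h3
        omega
    have v : ∀ l, 0 < d * l + r → HasValueAt ζ (summand (d * l + r)) ((1 - ζ ^ (3 * (d * l + r))) *
        (1 - ζ ^ (2 * (d * l + r))) * (1 - ζ ^ (d * l + r)) ^ 2 /
        ((1 - ζ) ^ 3 * (1 - ζ ^ (2 * (d * l + r) - 1)) *
          (2 ^ l * ∏ i ∈ range r, (1 + ζ ^ (i + 1))) ^ 4) *
        ((2 * l).factorial / (l.factorial : ℂ) ^ 2 *
      ((∏ i ∈ range (2 * r), (1 - ζ ^ (i + 1))) / (∏ i ∈ range r, (1 - ζ ^ (i + 1))) ^ 2)) ^ 3 *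
        (ζ ^ ((d * l + r) * (d * l + r + 3) / 2))⁻¹) := by
      intro l hl
      rw [summand_of_pos hl]
      exact (((((v1.sub (vq.pow _)).mul (v1.sub (vq.pow _))).mul ((v1.sub (vq.pow _)).pow 2)).div
        ((((v1.sub vq).pow 3).mul (v1.sub (vq.pow _))).mul ((vE l r).pow 4))
          (mul_ne_zero (mul_ne_zero (pow_ne_zero _ n1) (npole l hl))
            (pow_ne_zero _ (nE' l r)))).mul ((hasValueAt_qcb hζ (by omega) l h2).pow 3)).mul
          ((vq.pow _).inv (pow_ne_zero _ hζ0))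
    rcases Nat.eq_zero_or_pos r with rfl | hr0
    · refine ⟨0, fun l => ?_⟩
      rw [mul_zero]
      rcases Nat.eq_zero_or_pos l with rfl | hl
      · simpa [summand_zero] using HasValueAt.zero ζ
      · refine (v l (by positivity)).congr ?_
        rw [add_zero, pow_mul ζ d l, hζ.pow_eq_one]
        simp
    · refine ⟨(1 - ζ ^ (3 * r)) * (1 - ζ ^ (2 * r)) * (1 - ζ ^ r) ^ 2 /
        ((1 - ζ) ^ 3 * (1 - ζ ^ (2 * r - 1)) * (∏ i ∈ range r, (1 + ζ ^ (i + 1))) ^ 4) *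
        ((∏ i ∈ range (2 * r), (1 - ζ ^ (i + 1))) / (∏ i ∈ range r, (1 - ζ ^ (i + 1))) ^ 2) ^ 3 *
        (ζ ^ (r * (r + 3) / 2))⁻¹, fun l => (v l (by omega)).congr ?_⟩
      have npole' := npole l (by omega)
      obtain ⟨t, ht⟩ := triangle_shift hd l r
      rw [ht, show 3 * (d * l + r) = d * (3 * l) + 3 * r by ring,
        show 2 * (d * l + r) = d * (2 * l) + 2 * r by ring,
        show d * (2 * l) + 2 * r - 1 = d * (2 * l) + (2 * r - 1) by omega,
        hζ.pow_mul_add, hζ.pow_mul_add, hζ.pow_mul_add, hζ.pow_mul_add, hζ.pow_mul_add,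
        mul_pow _ _ 4, mul_pow _ _ 3, ← pow_mul, mul_comm l 4, pow_mul (2 : ℂ) 4 l, show (2 : ℂ) ^ 4 = 16 by norm_num]
      simp only [div_eq_mul_inv, mul_inv]
      ring
  · refine ⟨0, fun l => ?_⟩
    rw [mul_zero]
    have hk : 0 < d * l + r := by omega
    obtain ⟨u, ⟨a, hu⟩, h⟩ := qcb_eq_mul hζ l hr h2
    have n5 := one_sub_q_pow_ne_zero d (by omega)
    have vd : HasValueAt ζ (1 - q ^ d) 0 :=
      (v1.sub (vq.pow d)).congr (by rw [hζ.pow_eq_one, sub_self])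
    have hpole : ∃ b, HasValueAt ζ ((1 - q ^ d) / (1 - q ^ (2 * (d * l + r) - 1))) b := by
      by_cases hdvd : d ∣ 2 * (d * l + r) - 1
      · obtain ⟨t, ht⟩ := hdvd
        obtain ⟨w, hw, hw'⟩ := one_sub_q_pow_mul hζ t
        have ht0 : (t : ℂ) ≠ 0 := by
          rw [Nat.cast_ne_zero]
          rintro rfl
          omega
        have := hw.ne_zero ht0
        rw [ht, hw', div_mul_cancel_left₀ n5]
        exact ⟨_, hw.inv ht0⟩
      · refine ⟨_, vd.div (v1.sub (vq.pow _)) (sub_ne_zero.2 fun h => hdvd ?_)⟩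
        exact (hζ.pow_eq_one_iff_dvd _).1 h.symm
    obtain ⟨b, hb⟩ := hpole
    have e : summand (d * l + r) = (1 - q ^ d) ^ 2 * (((1 - q ^ d) /
        (1 - q ^ (2 * (d * l + r) - 1))) * ((1 - q ^ (3 * (d * l + r))) *
        (1 - q ^ (2 * (d * l + r))) * (1 - q ^ (d * l + r)) ^ 2 /
        ((1 - q) ^ 3 * (qpoch (-q) q (d * l + r)) ^ 4) * u ^ 3 *
          (q ^ ((d * l + r) * (d * l + r + 3) / 2))⁻¹)) := by
      rw [summand_of_pos hk, h]
      simp only [div_eq_mul_inv, mul_inv]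
      ring
    rw [e]
    refine ((vd.pow 2).mul (hb.mul ((((((v1.sub (vq.pow _)).mul (v1.sub (vq.pow _))).mul
      ((v1.sub (vq.pow _)).pow 2)).div (((v1.sub vq).pow 3).mul ((vE l r).pow 4)) ?_).mul
        (hu.pow 3)).mul ((vq.pow _).inv (pow_ne_zero _ hζ0))))).congr (by ring)
    exact mul_ne_zero (pow_ne_zero _ n1) (pow_ne_zero _ (nE' l r))

theorem hasValueAt_congrValue {n : ℕ} (hζ : IsPrimitiveRoot ζ d) (hd1 : 1 < d) (hn : Odd n)
    (hdn : d ∣ n) : HasValueAt ζ (congrValue n) 0 := by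
  obtain ⟨N, rfl⟩ := hn
  have hζ0 : ζ ≠ 0 := hζ.ne_zero (by omega)
  have vq := HasValueAt.q ζ
  have v1 := HasValueAt.one ζ
  have n1 : 1 - ζ ≠ 0 := by
    simpa using sub_ne_zero.2 (Ne.symm (hζ.pow_ne_one_of_pos_of_lt one_ne_zero hd1))
  have vY : HasValueAt ζ (1 - q ^ (2 * N + 1)) 0 :=
    (v1.sub (vq.pow _)).congr (by rw [(hζ.pow_eq_one_iff_dvd _).2 hdn, sub_self])
  rw [congrValue_eq]
  exact ((((vY.div (v1.sub vq) n1).mul ((vq.pow _).inv (pow_ne_zero _ hζ0))).mul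
    (v1.add (((((HasValueAt.natCast ζ _).pow 2).sub v1).div (HasValueAt.ofNat ζ 24)
      (by norm_num)).mul (vY.pow 2)))).add ((vY.pow 3).mul ((v1.add vq).div
        ((v1.sub vq).pow 3) (pow_ne_zero _ n1)))).congr (by ring)

theorem hasValueAt_sum_summand (hζ : IsPrimitiveRoot ζ d) (hd : Odd d) (hd1 : 1 < d) (m : ℕ) :
    HasValueAt ζ (∑ k ∈ range (d * m), summand k) 0 := by
  choose! c hc using fun r (hr : r < d) => hasValueAt_summand hζ hd hd1 hr
  have hblock : ∀ l, HasValueAt ζ (∑ r ∈ range d, summand (d * l + r))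
      (((2 * l).factorial / (l.factorial : ℂ) ^ 2) ^ 3 / 16 ^ l * ∑ r ∈ range d, c r) := by
    intro l
    rw [mul_sum]
    exact HasValueAt.sum _ fun r hr => hc r (mem_range.1 hr) l
  have hsum : ∑ r ∈ range d, c r = 0 := by
    have h0 := hblock 0
    simp only [mul_zero, zero_add, Nat.factorial_zero, Nat.cast_one, pow_zero, one_pow, div_one,
      one_mul] at h0
    obtain ⟨u, ⟨a, hu⟩, h⟩ := sum_summand_local hd1 hd hζ
    rw [sub_eq_iff_eq_add] at h
    have h1 := (((hasValueAt_cycl hζ (by omega)).pow 4).mul hu).add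
      (hasValueAt_congrValue hζ hd1 hd dvd_rfl)
    rw [← h] at h1
    rw [h0.unique h1]; ring
  induction m with
  | zero => simpa using HasValueAt.zero ζ
  | succ m ih =>
    rw [mul_add, mul_one, sum_range_add]
    exact (ih.add (hblock m)).congr (by rw [hsum]; ring)

end LowerRoot

theorem qintPoly_mul_dvd {n : ℕ} (hn : 1 < n) {p : ℚ[X]} (h : cyclotomic n ℚ ^ 4 ∣ p)
    (h' : ∀ d, d ∣ n → 1 < d → d < n → cyclotomic d ℚ ∣ p) :
    qintPoly n * cyclotomic n ℚ ^ 3 ∣ p := by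
  have hmem : n ∈ n.divisors.erase 1 := by simp; omega
  have e : qintPoly n * cyclotomic n ℚ ^ 3 =
      cyclotomic n ℚ ^ 4 * ∏ d ∈ (n.divisors.erase 1).erase n, cyclotomic d ℚ := by
    rw [qintPoly, ← prod_cyclotomic_eq_geom_sum (by omega), ← mul_prod_erase _ _ hmem]
    ring
  rw [e]
  refine IsCoprime.mul_dvd ?_ h (Finset.prod_dvd_of_coprime ?_ ?_)
  · refine IsCoprime.pow_left (IsCoprime.prod_right fun d hd => ?_)
    exact cyclotomic.isCoprime_rat (ne_of_mem_erase hd).symm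
  · intro a _ b _ hab
    exact cyclotomic.isCoprime_rat hab
  · intro d hd
    simp only [mem_erase, Nat.mem_divisors] at hd
    have h0 := Nat.pos_of_dvd_of_pos hd.2.2.1 (by omega)
    have h1 := Nat.le_of_dvd (by omega) hd.2.2.1
    exact h' d hd.2.2.1 (by omega) (by omega)

theorem stmt_0 (n : ℕ) (hn : 1 < n) (hodd : Odd n) :
    ratCongr
      (∑ k ∈ Finset.range n,
        qint (3 * k) * qint (2 * k) * (qint k) ^ 2 /
          (qint (2 * (k : ℤ) - 1) * (qpoch (-q) q k) ^ 4) *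
          (qcb k) ^ 3 * q ^ (-(((k : ℤ) ^ 2 + 3 * k) / 2)))
      (qint n * q ^ (-(((n : ℤ) + 1) / 2)) + (1 + q) * (qint n) ^ 3 +
        ((n : RatFunc ℚ) ^ 2 - 1) * (1 - q) ^ 2 / 24 * (qint n) ^ 3 * q ^ (-(((n : ℤ) + 1) / 2)))
      (qintPoly n * (Polynomial.cyclotomic n ℚ) ^ 3) := by
  change qintPoly n * cyclotomic n ℚ ^ 3 ∣ (∑ k ∈ range n, summand k - congrValue n).num
  refine qintPoly_mul_dvd hn ?_ fun d hdn hd1 _ => ?_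
  · have hζ := Complex.isPrimitiveRoot_exp n (by omega)
    obtain ⟨u, hu, h⟩ := sum_summand_local hn hodd hζ
    exact pow_dvd_num hζ (by omega) hu 4 h
  · have hζ := Complex.isPrimitiveRoot_exp d (by omega)
    obtain ⟨m, rfl⟩ := hdn
    have hd : Odd d := (Nat.odd_mul.1 hodd).1
    obtain ⟨u, hu, h⟩ := (((hasValueAt_sum_summand hζ hd hd1 m).sub
      (hasValueAt_congrValue hζ hd1 hodd (dvd_mul_right d m))).congr
        (sub_self 0)).exists_eq_mul hζ (by omega)
    simpa using pow_dvd_num hζ (by omega) hu 1 (by rw [h, pow_one])
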